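/- arXiv:math/0309165 — 3 statements merged into one kernel-verified Lean document; each statement's English description precedes it below -/
import Mathlib

section
/- There exists an L-structure 𝐀 = (A; (ρ_m)_{m≥1}) with universe A = ω_1 (a set of cardinality ℵ_1) such that: (1) Th(𝐀) is ω-categorical; (2) for every s ∈ ω, every finite partial automorphism of the reduct 𝐀^{[s]} = (A; ρ_1,…,ρ_s) extends to an automorphism of 𝐀^{[s]} (each reduct is homogeneous); (3) 𝐀 is rigid, i.e. Aut 𝐀 = {id_A}. Consequently, the countable set R = {ρ_m : m ≥ 1} of relations on A satisfies ⟨R⟩_{KA} = ⟨R⟩_{inv,∩} ≠ sInv Aut R; in particular there exists a set of finitary relations on a set of cardinality ℵ_1 that is ∩-closed and closed under all invariant operations but not Galois closed. -/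
open FirstOrder

/-- A finitary relation on `A` of arity `m+1` (so all arities are ≥ 1). -/
def Rels (A : Type*) : Type _ := Σ m : ℕ, Set (Fin (m + 1) → A)

/-- The image `g[ρ]` of a relation under a permutation. -/
def permImage {A : Type*} (g : Equiv.Perm A) {m : ℕ} (ρ : Set (Fin m → A)) :
    Set (Fin m → A) := (fun a => ⇑g ∘ a) '' ρ

/-- `Aut R`: permutations strongly preserving every relation in `R`. -/
def AutR {A : Type*} (R : Set (Rels A)) : Set (Equiv.Perm A) :=
  {g | ∀ ρ ∈ R, permImage g ρ.2 = ρ.2}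

/-- `sInv G`: relations strongly invariant under every permutation in `G`. -/
def sInvG {A : Type*} (G : Set (Equiv.Perm A)) : Set (Rels A) :=
  {ρ | ∀ g ∈ G, permImage g ρ.2 = ρ.2}

/-- The language with relation symbols `P i` of arity `k i`, for `i : Fin n`. -/
def relLang (n : ℕ) (k : Fin n → ℕ) : Language where
  Functions := fun _ => Empty
  Relations := fun m => {i : Fin n // k i = m}

/-- The structure on `A` interpreting `P i` as `ρ i`. -/
def relStruct {A : Type*} {n : ℕ} {k : Fin n → ℕ}
    (ρ : ∀ i : Fin n, Set (Fin (k i) → A)) : (relLang n k).Structure A where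
  funMap := fun f _ => f.elim
  RelMap := fun {m} r x => (fun j => x (Fin.cast r.2 j)) ∈ ρ r.1

/-- The logical operation given by a first-order formula `φ` with `m` free
variables, applied to the relations `ρ i`. -/
def logicalOp {A : Type*} {n : ℕ} {k : Fin n → ℕ}
    (ρ : ∀ i : Fin n, Set (Fin (k i) → A)) {m : ℕ}
    (φ : (relLang n k).Formula (Fin m)) : Set (Fin m → A) :=
  letI := relStruct ρ
  {a | φ.Realize a}

/-- `R` is closed under all logical operations (i.e. `R` is a Krasner algebra). -/
def KrasnerClosed {A : Type*} (R : Set (Rels A)) : Prop :=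
  ∀ (n : ℕ) (k : Fin n → ℕ) (ρ : ∀ i : Fin n, Set (Fin (k i + 1) → A)),
    (∀ i, (⟨k i, ρ i⟩ : Rels A) ∈ R) →
    ∀ (m : ℕ) (φ : (relLang n (fun i => k i + 1)).Formula (Fin (m + 1))),
      (⟨m, logicalOp ρ φ⟩ : Rels A) ∈ R

/-- `R` is ∩-closed: it contains each `A^m` and is closed under arbitrary
intersections of relations of equal arity. -/
def InterClosed {A : Type*} (R : Set (Rels A)) : Prop :=
  (∀ m : ℕ, (⟨m, Set.univ⟩ : Rels A) ∈ R) ∧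
  ∀ (m : ℕ) (Q : Set (Set (Fin (m + 1) → A))),
    (∀ ρ ∈ Q, (⟨m, ρ⟩ : Rels A) ∈ R) → (⟨m, ⋂₀ Q⟩ : Rels A) ∈ R

/-- `⟨Q⟩_{KA}`: the Krasner algebra generated by `Q`. -/
def KAClosure {A : Type*} (Q : Set (Rels A)) : Set (Rels A) :=
  ⋂₀ {R | Q ⊆ R ∧ KrasnerClosed R}

/-- `f` (restricted to `s`) is a partial automorphism of `Q`. -/
def IsPartialAuto {A : Type*} (Q : Set (Rels A)) (s : Set A) (f : A → A) : Prop :=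
  Set.InjOn f s ∧ ∀ ρ ∈ Q, ∀ a : Fin ((Sigma.fst ρ) + 1) → A,
    (∀ i, a i ∈ s) → (a ∈ ρ.2 ↔ f ∘ a ∈ ρ.2)

/-- `Q` is homogeneous: every finite partial automorphism of `Q` extends to an
automorphism of `Q`. -/
def Homogeneous {A : Type*} (Q : Set (Rels A)) : Prop :=
  ∀ (s : Set A), s.Finite → ∀ f : A → A, IsPartialAuto Q s f →
    ∃ g ∈ AutR Q, ∀ x ∈ s, g x = f x

/-- An invariant (finitary) operation on relations. -/
def Invariant {A : Type*} {n : ℕ} {k : Fin n → ℕ} {m : ℕ}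
    (F : (∀ i : Fin n, Set (Fin (k i + 1) → A)) → Set (Fin (m + 1) → A)) : Prop :=
  ∀ (g : Equiv.Perm A) (ρ : ∀ i : Fin n, Set (Fin (k i + 1) → A)),
    F (fun i => permImage g (ρ i)) = permImage g (F ρ)

/-- `R` is closed under all invariant (finitary) operations. -/
def InvClosed {A : Type*} (R : Set (Rels A)) : Prop :=
  ∀ (n : ℕ) (k : Fin n → ℕ) (m : ℕ)
    (F : (∀ i : Fin n, Set (Fin (k i + 1) → A)) → Set (Fin (m + 1) → A)),
    Invariant F → ∀ ρ : ∀ i : Fin n, Set (Fin (k i + 1) → A),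
      (∀ i, (⟨k i, ρ i⟩ : Rels A) ∈ R) → (⟨m, F ρ⟩ : Rels A) ∈ R

/-- `⟨Q⟩_{inv,∩}`: the least ∩-closed set containing `Q` and closed under all
invariant operations. -/
def invInterClosure {A : Type*} (Q : Set (Rels A)) : Set (Rels A) :=
  ⋂₀ {R | Q ⊆ R ∧ InvClosed R ∧ InterClosed R}

/-- The language with exactly one relation symbol of arity `m` for each
`m ≥ 1` (the symbol of arity `k+1` is recorded by the witness `k`). -/
def Lrel : Language where
  Functions := fun _ => Empty
  Relations := fun m => {k : ℕ // k + 1 = m}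

/-- The `Lrel`-structure on `A` interpreting the `(k+1)`-ary symbol as `ρ k`. -/
def LrelStruct {A : Type*} (ρ : ∀ k : ℕ, Set (Fin (k + 1) → A)) :
    Lrel.Structure A where
  funMap := fun f _ => f.elim
  RelMap := fun {m} r x => (fun j => x (Fin.cast r.2 j)) ∈ ρ r.1
/-- `Th(A; (ρ_k)_k)` is ω-categorical: it has, up to isomorphism, exactly one
countable model. -/
def OmegaCategoricalTh {A : Type} (ρ : ∀ k : ℕ, Set (Fin (k + 1) → A)) : Prop :=
  letI := LrelStruct ρ
  (∃ M : Language.Theory.ModelType.{0, 0, 0} (Lrel.completeTheory A), Cardinal.mk M = Cardinal.aleph0) ∧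
  Cardinal.Categorical.{0, 0, 0} Cardinal.aleph0 (Lrel.completeTheory A)

namespace KK

structure GoodL {W : Type} [LinearOrder W] (L : W × ℕ → Set (Finset (W × ℕ))) : Prop where
  lt : ∀ p, ∀ e ∈ L p, ∀ x ∈ e, x.1 < p.1
  rich : ∀ (w : W) (P : Set (Finset (W × ℕ))), P.Finite → (∀ e ∈ P, ∀ x ∈ e, x.1 < w) →
    ∃ n, L (w, n) = P
  fin : ∀ p (s : ℕ), {e | e ∈ L p ∧ e.card ≤ s}.Finite
  below : ∀ (p : W × ℕ) (v : W), v < p.1 → {e | e ∈ L p ∧ ∀ x ∈ e, x.1 < v}.Finite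
  special : ∀ w : W, (∃ v, v < w) → ∃ p : W × ℕ, p.1 = w ∧
    (∀ q : W × ℕ, q.1 = w → q ≠ p → (L q).Finite) ∧
    ∃ f : ℕ → W × ℕ, Set.range f = {x | x.1 < w} ∧
      L p = Set.range (fun k => (Finset.range k).image f)

theorem chain_fin {A : Type} [DecidableEq A] (f : ℕ → A) (hf : (Set.range f).Infinite) (s : ℕ) :
    {e | e ∈ Set.range (fun k => (Finset.range k).image f) ∧ e.card ≤ s}.Finite := by
  obtain ⟨t, ht, hts⟩ := hf.exists_subset_card_eq (s + 1)
  have : ∃ K, t ⊆ (Finset.range K).image f := by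
    clear hts
    induction t using Finset.induction_on with
    | empty => exact ⟨0, by simp⟩
    | insert a t ha ih =>
      obtain ⟨K, hK⟩ := ih (fun x hx => ht (by simp at hx ⊢; exact Or.inr hx))
      obtain ⟨i, hi⟩ := ht (show a ∈ (↑(insert a t) : Set A) by simp)
      refine ⟨max K (i + 1), ?_⟩
      intro x hx
      rw [Finset.mem_insert] at hx
      rcases hx with rfl | hx
      · exact Finset.mem_image.2 ⟨i, by simp, hi⟩
      · obtain ⟨j, hj, hj'⟩ := Finset.mem_image.1 (hK hx)
        exact Finset.mem_image.2 ⟨j, by simp at hj ⊢; omega, hj'⟩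
  obtain ⟨K, hK⟩ := this
  refine ((Finset.range K).finite_toSet.image (fun k => (Finset.range k).image f)).subset ?_
  rintro e ⟨⟨k, rfl⟩, hk⟩
  refine ⟨k, ?_, rfl⟩
  simp only [Finset.coe_range, Set.mem_Iio]
  by_contra hlt
  have h1 : t ⊆ (Finset.range k).image f := hK.trans (Finset.image_subset_image (by
    intro x; simp; omega))
  have := Finset.card_le_card h1
  simp only at hk
  omega

theorem exists_L (W : Type) [LinearOrder W] (hc : ∀ w : W, (Set.Iio w).Countable) :
    ∃ L : W × ℕ → Set (Finset (W × ℕ)), GoodL L := by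
  have hT : ∀ w : W, {x : W × ℕ | x.1 < w}.Countable := by
    intro w
    have : {x : W × ℕ | x.1 < w} = Set.Iio w ×ˢ Set.univ := by ext x; simp
    rw [this]
    exact (hc w).prod Set.countable_univ
  have hE : ∀ w : W, {e : Finset (W × ℕ) | ∀ x ∈ e, x.1 < w}.Countable := by
    intro w
    have := (Set.countable_ofPred_finite_subset (hT w)).preimage_of_injOn
      (f := fun e : Finset (W × ℕ) => (e : Set (W × ℕ))) (by intro a _ b _ h; simpa using h)
    refine this.mono ?_
    intro e he
    exact ⟨e.finite_toSet, fun x hx => he x hx⟩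
  have hP : ∀ w : W, ∃ F : ℕ → Set (Finset (W × ℕ)),
      {P | P.Finite ∧ P ⊆ {e : Finset (W × ℕ) | ∀ x ∈ e, x.1 < w}} = Set.range F := fun w =>
    (Set.countable_ofPred_finite_subset (hE w)).exists_eq_range ⟨∅, by simp⟩
  choose F hF using hP
  have hf : ∀ w : W, ∃ f : ℕ → W × ℕ, (∃ v, v < w) → {x : W × ℕ | x.1 < w} = Set.range f := by
    intro w
    by_cases h : ∃ v, v < w
    · obtain ⟨v, hv⟩ := h
      obtain ⟨f, hf⟩ := (hT w).exists_eq_range ⟨(v, 0), hv⟩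
      exact ⟨f, fun _ => hf⟩
    · exact ⟨fun _ => (w, 0), fun h' => (h h').elim⟩
  choose f hf using hf
  have hinf : ∀ w, (∃ v, v < w) → (Set.range (f w)).Infinite := by
    rintro w ⟨v, hv⟩
    rw [← hf w ⟨v, hv⟩]
    refine (Set.infinite_range_of_injective (f := fun n : ℕ => (v, n)) ?_).mono ?_
    · intro a b h; simpa using h
    · rintro _ ⟨n, rfl⟩; exact hv
  classical
  let L : W × ℕ → Set (Finset (W × ℕ)) := fun p => match p with
    | (w, 0) => if ∃ v, v < w then Set.range (fun k => (Finset.range k).image (f w)) else ∅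
    | (w, n + 1) => F w n
  have hL0 : ∀ w, (∃ v, v < w) →
    L (w, 0) = Set.range (fun k => (Finset.range k).image (f w)) := fun w h => if_pos h
  have hL0' : ∀ w, ¬ (∃ v, v < w) → L (w, 0) = ∅ := fun w h => if_neg h
  have hL1 : ∀ w n, (L (w, n + 1)).Finite ∧ ∀ e ∈ L (w, n + 1), ∀ x ∈ e, x.1 < w := by
    intro w n
    have : F w n ∈ Set.range (F w) := ⟨n, rfl⟩
    rw [← hF] at this
    exact ⟨this.1, fun e he => this.2 he⟩
  refine ⟨L, ?_, ?_, ?_, ?_, ?_⟩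
  · rintro ⟨w, n⟩ e he x hx
    cases n with
    | zero =>
      by_cases h : ∃ v, v < w
      · rw [hL0 w h] at he
        obtain ⟨k, rfl⟩ := he
        obtain ⟨i, _, rfl⟩ := Finset.mem_image.1 hx
        have : f w i ∈ Set.range (f w) := ⟨i, rfl⟩
        rw [← hf w h] at this
        exact this
      · rw [hL0' w h] at he; exact he.elim
    | succ n => exact (hL1 w n).2 e he x hx
  · intro w P h1 h2
    have : P ∈ Set.range (F w) := by rw [← hF]; exact ⟨h1, h2⟩
    obtain ⟨n, hn⟩ := this
    exact ⟨n + 1, hn⟩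
  · rintro ⟨w, n⟩ s
    cases n with
    | zero =>
      by_cases h : ∃ v, v < w
      · rw [hL0 w h]; exact chain_fin _ (hinf w h) s
      · rw [hL0' w h]; simp
    | succ n => exact (hL1 w n).1.subset (fun e he => he.1)
  · rintro ⟨w, n⟩ v hv
    cases n with
    | zero =>
      have h : ∃ v, v < w := ⟨v, hv⟩
      rw [hL0 w h]
      have : (v, 0) ∈ Set.range (f w) := by rw [← hf w h]; exact hv
      obtain ⟨i, hi⟩ := this
      refine ((Finset.range (i+1)).finite_toSet.image (fun k => (Finset.range k).image (f w))).subset ?_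
      rintro e ⟨⟨k, rfl⟩, hk⟩
      refine ⟨k, ?_, rfl⟩
      by_contra hlt
      have := hk (f w i) (Finset.mem_image.2 ⟨i, by simp at hlt ⊢; omega, rfl⟩)
      rw [hi] at this
      exact lt_irrefl _ this
    | succ n => exact (hL1 w n).1.subset (fun e he => he.1)
  · intro w h
    refine ⟨(w, 0), rfl, ?_, f w, (hf w h).symm, hL0 w h⟩
    rintro ⟨w', n⟩ h1 h2
    simp only at h1
    subst h1
    cases n with
    | zero => exact (h2 rfl).elim
    | succ n => exact (hL1 _ n).1

/-- back-and-forth along a countable set -/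
theorem bf {M N : Type} (Q : Set (M × N) → Prop) (U : Set M) (V : Set N)
    (hU : U.Countable) (hV : V.Countable)
    (h1 : ∀ G, Q G → ∀ a ∈ U, ∃ G', G ⊆ G' ∧ Q G' ∧ ∃ b, (a, b) ∈ G')
    (h2 : ∀ G, Q G → ∀ b ∈ V, ∃ G', G ⊆ G' ∧ Q G' ∧ ∃ a, (a, b) ∈ G')
    (G0 : Set (M × N)) (h0 : Q G0) :
    ∃ S : ℕ → Set (M × N), Monotone S ∧ S 0 = G0 ∧ (∀ n, Q (S n)) ∧
      (∀ a ∈ U, ∃ b n, (a, b) ∈ S n) ∧ (∀ b ∈ V, ∃ a n, (a, b) ∈ S n) := by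
  have : Countable (U ⊕ V) := by
    have := hU.to_subtype
    have := hV.to_subtype
    infer_instance
  obtain ⟨en, hen⟩ : ∃ en : ℕ → Option (U ⊕ V), Function.Surjective en :=
    exists_surjective_nat _
  have step : ∀ (x : Option (U ⊕ V)) (G : {G // Q G}), ∃ G' : {G // Q G}, G.1 ⊆ G'.1 ∧
      (∀ a : U, x = some (Sum.inl a) → ∃ b, (a.1, b) ∈ G'.1) ∧
      (∀ b : V, x = some (Sum.inr b) → ∃ a, (a, b.1) ∈ G'.1) := by
    rintro (_ | a | b) ⟨G, hG⟩
    · exact ⟨⟨G, hG⟩, subset_rfl, by simp, by simp⟩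
    · obtain ⟨G', h, hQ, h'⟩ := h1 G hG a.1 a.2
      exact ⟨⟨G', hQ⟩, h, by rintro c ⟨⟩; exact h', by simp⟩
    · obtain ⟨G', h, hQ, h'⟩ := h2 G hG b.1 b.2
      exact ⟨⟨G', hQ⟩, h, by simp, by rintro c ⟨⟩; exact h'⟩
  choose nx hnx using step
  let S : ℕ → {G // Q G} := fun n => Nat.rec ⟨G0, h0⟩ (fun n G => nx (en n) G) n
  have hS : ∀ n, S (n + 1) = nx (en n) (S n) := fun n => rfl
  refine ⟨fun n => (S n).1, monotone_nat_of_le_succ ?_, rfl, fun n => (S n).2, ?_, ?_⟩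
  · intro n; rw [hS]; exact (hnx _ _).1
  · intro a ha
    obtain ⟨n, hn⟩ := hen (some (Sum.inl ⟨a, ha⟩))
    obtain ⟨b, hb⟩ := (hnx (en n) (S n)).2.1 ⟨a, ha⟩ hn
    exact ⟨b, n + 1, by show _ ∈ (S (n+1)).1; rw [hS]; exact hb⟩
  · intro b hb
    obtain ⟨n, hn⟩ := hen (some (Sum.inr ⟨b, hb⟩))
    obtain ⟨a, ha⟩ := (hnx (en n) (S n)).2.2 ⟨b, hb⟩ hn
    exact ⟨a, n + 1, by show _ ∈ (S (n+1)).1; rw [hS]; exact ha⟩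
end KK
namespace KK

def RR {W : Type} [LinearOrder W] (L : W × ℕ → Set (Finset (W × ℕ))) : Set (Finset (W × ℕ)) :=
  {E | ∃ p ∈ E, E.erase p ∈ L p}

theorem RR_top {W : Type} [LinearOrder W] {L : W × ℕ → Set (Finset (W × ℕ))} (hL : GoodL L)
    (b : W × ℕ) (e : Finset (W × ℕ)) (he : ∀ x ∈ e, x.1 < b.1) :
    insert b e ∈ RR L ↔ e ∈ L b := by
  have hb : b ∉ e := fun h => lt_irrefl _ (he b h)
  constructor
  · rintro ⟨p, hp, h⟩
    rw [Finset.mem_insert] at hp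
    rcases hp with rfl | hp
    · rwa [Finset.erase_insert hb] at h
    · have h1 := hL.lt p _ h b (by
        rw [Finset.mem_erase]; exact ⟨fun h => hb (h ▸ hp), by simp⟩)
      exact (lt_asymm h1 (he p hp)).elim
  · intro h
    exact ⟨b, by simp, by rwa [Finset.erase_insert hb]⟩

def PI {A : Type} [DecidableEq A] (R : Set (Finset A)) (s : ℕ) (G : Set (A × A)) : Prop :=
  (∀ p ∈ G, ∀ q ∈ G, p.1 = q.1 ↔ p.2 = q.2) ∧
  ∀ e : Finset (A × A), (e : Set (A × A)) ⊆ G → e.card ≤ s →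
    (e.image Prod.fst ∈ R ↔ e.image Prod.snd ∈ R)

theorem PI.swap {A : Type} [DecidableEq A] {R : Set (Finset A)} {s : ℕ} {G : Set (A × A)}
    (h : PI R s G) : PI R s (Prod.swap ⁻¹' G) := by
  refine ⟨fun p hp q hq => (h.1 _ hp _ hq).symm, fun e he hs => ?_⟩
  have := h.2 (e.image Prod.swap) (by
    intro x hx
    simp only [Finset.coe_image, Set.mem_image] at hx
    obtain ⟨y, hy, rfl⟩ := hx
    exact he hy) (Finset.card_image_le.trans hs)
  rw [Finset.image_image, Finset.image_image] at this
  exact this.symm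

theorem PI.sUnion {A : Type} [DecidableEq A] {R : Set (Finset A)} {s : ℕ} (c : Set (Set (A × A)))
    (hc : DirectedOn (· ⊆ ·) c) (hne : c.Nonempty)
    (h : ∀ G ∈ c, PI R s G) : PI R s (⋃₀ c) := by
  have key : ∀ e : Finset (A × A), (e : Set (A × A)) ⊆ ⋃₀ c → ∃ G ∈ c, (e : Set (A × A)) ⊆ G := by
    intro e he
    exact DirectedOn.exists_mem_subset_of_finset_subset_biUnion (f := id) hne hc (by
      simpa [Set.sUnion_eq_biUnion] using he)
  constructor
  · intro p hp q hq
    obtain ⟨G, hG, hs⟩ := key {p, q} (by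
      intro x hx; simp at hx; rcases hx with rfl | rfl <;> assumption)
    exact (h G hG).1 p (hs (by simp)) q (hs (by simp))
  · intro e he
    obtain ⟨G, hG, hs⟩ := key e he
    exact (h G hG).2 e hs

def Good {A : Type} [DecidableEq A] (R : Set (Finset A)) (s : ℕ) (D : Set A) : Prop :=
  ∀ C : Finset A, C.Nonempty → (∀ x ∈ C, x ∉ D) →
    {e : Finset A | (e : Set A) ⊆ D ∧ e ∪ C ∈ R ∧ (e ∪ C).card ≤ s}.Finite

theorem Good.insert {A : Type} [DecidableEq A] {R : Set (Finset A)} {s : ℕ} {D : Set A}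
    (h : Good R s D) (a : A) : Good R s (insert a D) := by
  by_cases ha : a ∈ D
  · rwa [Set.insert_eq_of_mem ha]
  intro C hC hCD
  have h1 := h C hC (fun x hx hD => hCD x hx (Or.inr hD))
  have h2 := h (Insert.insert a C) (by simp) (by
    intro x hx
    rw [Finset.mem_insert] at hx
    rcases hx with rfl | hx
    · exact ha
    · exact fun hD => hCD x hx (Or.inr hD))
  refine (h1.union (h2.image (Insert.insert a))).subset ?_
  rintro e ⟨he, heR, hs⟩
  by_cases hae : a ∈ e
  · right
    refine ⟨e.erase a, ⟨?_, ?_⟩, Finset.insert_erase hae⟩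
    · intro x hx
      simp only [Finset.coe_erase, Set.mem_sdiff, Finset.mem_coe, Set.mem_singleton_iff] at hx
      exact (he hx.1).resolve_left hx.2
    · have : e.erase a ∪ Insert.insert a C = e ∪ C := by
        rw [Finset.union_insert, ← Finset.insert_union, Finset.insert_erase hae]
      rw [this]; exact ⟨heR, hs⟩
  · left
    refine ⟨?_, heR, hs⟩
    intro x hx
    exact (he hx).resolve_left (fun h => hae (h ▸ hx))

theorem Good.of_finite {A : Type} [DecidableEq A] (R : Set (Finset A)) (s : ℕ) {D : Set A}
    (h : D.Finite) : Good R s D := by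
  intro C _ _
  have := (h.finite_subsets).preimage
      (f := fun e : Finset A => (e : Set A)) (by intro a _ b _ h; simpa using h)
  exact this.subset (fun e he => he.1)

theorem Good.of_lower {W : Type} [LinearOrder W] {L : W × ℕ → Set (Finset (W × ℕ))}
    (hL : GoodL L) (s : ℕ) (I : Set W) (hI : IsLowerSet I) :
    Good (RR L) s {x : W × ℕ | x.1 ∈ I} := by
  intro C hC hCD
  have : (⋃ p ∈ C, (fun e => (Insert.insert p e) \ C) '' {e | e ∈ L p ∧ e.card ≤ s}).Finite := by
    refine Set.Finite.biUnion C.finite_toSet ?_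
    intro p _
    exact (hL.fin p s).image _
  refine this.subset ?_
  rintro e ⟨he, ⟨p, hp, hpL⟩, hs⟩
  have hpC : p ∈ C := by
    by_contra hpC
    have hpe : p ∈ e := (Finset.mem_union.1 hp).resolve_right hpC
    obtain ⟨c, hc⟩ := hC
    have hlt := hL.lt p _ hpL c (by
      rw [Finset.mem_erase]; exact ⟨fun h => hpC (h ▸ hc), Finset.mem_union_right _ hc⟩)
    exact hCD c hc (hI hlt.le (he hpe))
  refine Set.mem_biUnion hpC ⟨(e ∪ C).erase p, ⟨hpL, (Finset.card_erase_le).trans hs⟩, ?_⟩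
  simp only [Finset.insert_erase hp]
  have hd : Disjoint e C := by
    rw [Finset.disjoint_left]
    intro x hx hx'
    exact hCD x hx' (he hx)
  rw [Finset.union_sdiff_right, Finset.sdiff_eq_self_of_disjoint hd]

theorem ext1 {W : Type} [LinearOrder W] {L : W × ℕ → Set (Finset (W × ℕ))}
    (hL : GoodL L) (s : ℕ) (G : Set ((W × ℕ) × (W × ℕ))) (hG : PI (RR L) s G)
    (hD : Good (RR L) s (Prod.fst '' G)) (a : W × ℕ) (ha : a ∉ Prod.fst '' G)
    (η : W) (hη : ∀ p ∈ G, p.2.1 < η) :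
    ∃ b : W × ℕ, b.1 = η ∧ PI (RR L) s (insert (a, b) G) := by
  let T : Set (Finset ((W × ℕ) × (W × ℕ))) :=
    {e | (e : Set _) ⊆ G ∧ e.card < s ∧ insert a (e.image Prod.fst) ∈ RR L}
  have inj1 : ∀ e e' : Finset ((W × ℕ) × (W × ℕ)), (e : Set _) ⊆ G → (e' : Set _) ⊆ G →
      e.image Prod.fst = e'.image Prod.fst → e ⊆ e' := by
    intro e e' he he' h x hx
    have : x.1 ∈ e'.image Prod.fst := h ▸ Finset.mem_image_of_mem _ hx
    obtain ⟨y, hy, hxy⟩ := Finset.mem_image.1 this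
    have := (hG.1 y (he' hy) x (he hx)).1 hxy
    have : y = x := Prod.ext hxy this
    exact this ▸ hy
  have inj2 : ∀ e e' : Finset ((W × ℕ) × (W × ℕ)), (e : Set _) ⊆ G → (e' : Set _) ⊆ G →
      e.image Prod.snd = e'.image Prod.snd → e ⊆ e' := by
    intro e e' he he' h x hx
    have : x.2 ∈ e'.image Prod.snd := h ▸ Finset.mem_image_of_mem _ hx
    obtain ⟨y, hy, hxy⟩ := Finset.mem_image.1 this
    have := (hG.1 y (he' hy) x (he hx)).2 hxy
    have : y = x := Prod.ext this hxy
    exact this ▸ hy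
  have hT : T.Finite := by
    have h1 := hD {a} (by simp) (by intro x hx; rw [Finset.mem_singleton] at hx; exact hx ▸ ha)
    refine Set.Finite.of_finite_image (f := fun e => e.image Prod.fst) (h1.subset ?_) ?_
    · rintro _ ⟨e, ⟨he, hs, hR⟩, rfl⟩
      refine ⟨?_, ?_, ?_⟩
      · intro x hx
        simp only [Finset.coe_image] at hx
        exact Set.image_mono he hx
      · rw [Finset.union_comm, ← Finset.insert_eq]; exact hR
      · rw [Finset.union_comm, ← Finset.insert_eq]
        have h1 : (e.image Prod.fst).card ≤ e.card := Finset.card_image_le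
        have h2 := Finset.card_insert_le a (e.image Prod.fst)
        exact h2.trans (by omega)
    · intro e he e' he' h
      exact (inj1 e e' he.1 he'.1 h).antisymm (inj1 e' e he'.1 he.1 h.symm)
  obtain ⟨n, hn⟩ := hL.rich η ((fun e => e.image Prod.snd) '' T) (hT.image _) (by
    rintro _ ⟨e, he, rfl⟩ x hx
    obtain ⟨y, hy, rfl⟩ := Finset.mem_image.1 hx
    exact hη y (he.1 hy))
  have hbG : ∀ p ∈ G, p.2 ≠ (η, n) := by
    intro p hp h
    have := hη p hp
    rw [h] at this
    exact lt_irrefl _ this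
  have haG : ∀ p ∈ G, p.1 ≠ a := fun p hp h => ha ⟨p, hp, h⟩
  refine ⟨(η, n), rfl, ?_, ?_⟩
  · rintro p (rfl | hp) q (rfl | hq)
    · simp
    · exact iff_of_false (haG q hq).symm (hbG q hq).symm
    · exact iff_of_false (haG p hp) (hbG p hp)
    · exact hG.1 p hp q hq
  · intro e he hs
    by_cases hmem : (a, ((η, n) : W × ℕ)) ∈ e
    · obtain ⟨e0, hne, rfl⟩ : ∃ e0, (a, ((η, n) : W × ℕ)) ∉ e0 ∧ e = insert (a, (η, n)) e0 :=
        ⟨e.erase _, Finset.notMem_erase _ _, (Finset.insert_erase hmem).symm⟩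
      rw [Finset.card_insert_of_notMem hne] at hs
      have he0 : (e0 : Set _) ⊆ G := by
        intro x hx
        exact (he (by simp only [Finset.coe_insert]; exact Or.inr hx)).resolve_left
          (fun h => hne (h ▸ hx))
      rw [Finset.image_insert, Finset.image_insert]
      rw [RR_top hL (η, n) (e0.image Prod.snd) (by
        intro x hx
        obtain ⟨y, hy, rfl⟩ := Finset.mem_image.1 hx
        exact hη y (he0 hy)), hn]
      constructor
      · intro h
        exact ⟨e0, ⟨he0, by omega, h⟩, rfl⟩
      · rintro ⟨e1, he1, h⟩
        have : e1 = e0 := (inj2 e1 e0 he1.1 he0 h).antisymm (inj2 e0 e1 he0 he1.1 h.symm)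
        exact this ▸ he1.2.2
    · refine hG.2 e ?_ hs
      intro x hx
      exact (he hx).resolve_left (fun h => hmem (h ▸ hx))

end KK
namespace KK

theorem step {W : Type} [LinearOrder W] {L : W × ℕ → Set (Finset (W × ℕ))}
    (hL : GoodL L) (hc : ∀ w : W, (Set.Iio w).Countable) (hub : ∀ w : W, ∃ v, w < v)
    (s : ℕ) (G0 : Set ((W × ℕ) × (W × ℕ))) (hG : PI (RR L) s G0)
    (hD : Good (RR L) s (Prod.fst '' G0)) (hE : Good (RR L) s (Prod.snd '' G0))
    (w : W) (hw : ∀ p ∈ G0, p.1.1 ≤ w ∧ p.2.1 ≤ w) :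
    ∃ (G : Set ((W × ℕ) × (W × ℕ))) (S : Set W), G0 ⊆ G ∧ PI (RR L) s G ∧ IsLowerSet S ∧
      w ∈ S ∧ Prod.fst '' G = {x | x.1 ∈ S} ∧ Prod.snd '' G = {x | x.1 ∈ S} := by
  choose t ht using hub
  let S : Set W := {v | ∃ n : ℕ, v ≤ t^[n] w}
  have hSlow : IsLowerSet S := by
    rintro a b hab ⟨n, hn⟩
    exact ⟨n, hab.trans hn⟩
  have hwS : w ∈ S := ⟨0, le_rfl⟩
  have hSup : ∀ v ∈ S, ∃ v' ∈ S, v < v' := by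
    rintro v ⟨n, hn⟩
    refine ⟨t^[n+1] w, ⟨n + 1, le_rfl⟩, hn.trans_lt ?_⟩
    rw [Function.iterate_succ_apply']; exact ht _
  have hSc : {x : W × ℕ | x.1 ∈ S}.Countable := by
    have h1 : S ⊆ ⋃ n : ℕ, Set.Iio (t^[n+1] w) := by
      rintro v ⟨n, hn⟩
      refine Set.mem_iUnion.2 ⟨n, hn.trans_lt ?_⟩
      rw [Function.iterate_succ_apply']; exact ht _
    have h2 : S.Countable := (Set.countable_iUnion (fun n => hc _)).mono h1
    have : {x : W × ℕ | x.1 ∈ S} = S ×ˢ Set.univ := by ext x; simp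
    rw [this]
    exact h2.prod Set.countable_univ
  have hmax : ∀ a ∈ S, ∀ b ∈ S, max a b ∈ S := by
    intro a ha b hb
    rcases max_choice a b with h | h <;> rw [h] <;> assumption
  let Q : Set ((W × ℕ) × (W × ℕ)) → Prop := fun G => PI (RR L) s G ∧
    Good (RR L) s (Prod.fst '' G) ∧ Good (RR L) s (Prod.snd '' G) ∧
    ∃ η ∈ S, ∀ p ∈ G, p.1.1 ≤ η ∧ p.2.1 ≤ η
  have hQ1 : ∀ G, Q G → ∀ a ∈ {x : W × ℕ | x.1 ∈ S}, ∃ G', G ⊆ G' ∧ Q G' ∧ ∃ b, (a, b) ∈ G' := by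
    rintro G ⟨q1, q2, q3, η, hη, q4⟩ a ha
    by_cases haG : a ∈ Prod.fst '' G
    · obtain ⟨p, hp, rfl⟩ := haG
      exact ⟨G, subset_rfl, ⟨q1, q2, q3, η, hη, q4⟩, p.2, hp⟩
    obtain ⟨η', h1, h2⟩ := hSup _ (hmax η hη a.1 ha)
    have h3 := (le_max_left η a.1).trans_lt h2
    have h4 := (le_max_right η a.1).trans_lt h2
    obtain ⟨b, hb, hPI⟩ := ext1 hL s G q1 q2 a haG η' (fun p hp => (q4 p hp).2.trans_lt h3)
    refine ⟨insert (a, b) G, Set.subset_insert _ _, ⟨hPI, ?_, ?_, η', h1, ?_⟩, b, Or.inl rfl⟩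
    · rw [Set.image_insert_eq]; exact q2.insert a
    · rw [Set.image_insert_eq]; exact q3.insert b
    · rintro p (rfl | hp)
      · exact ⟨h4.le, hb.le⟩
      · exact ⟨(q4 p hp).1.trans h3.le, (q4 p hp).2.trans h3.le⟩
  have hsw : ∀ G, Q G → Q (Prod.swap ⁻¹' G) := by
    rintro G ⟨q1, q2, q3, η, hη, q4⟩
    refine ⟨q1.swap, ?_, ?_, η, hη, fun p hp => (q4 _ hp).symm⟩
    · rw [← Set.image_swap_eq_preimage_swap, Set.image_image]; exact q3
    · rw [← Set.image_swap_eq_preimage_swap, Set.image_image]; exact q2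
  have hQ2 : ∀ G, Q G → ∀ b ∈ {x : W × ℕ | x.1 ∈ S}, ∃ G', G ⊆ G' ∧ Q G' ∧ ∃ a, (a, b) ∈ G' := by
    intro G hG b hb
    obtain ⟨G', h1, h2, a, ha⟩ := hQ1 _ (hsw G hG) b hb
    exact ⟨Prod.swap ⁻¹' G', fun p hp => h1 (show p.swap.swap ∈ G by simpa using hp),
      hsw _ h2, a, ha⟩
  obtain ⟨T, hT1, hT2, hT3, hT4, hT5⟩ := bf Q _ _ hSc hSc hQ1 hQ2 G0 ⟨hG, hD, hE, w, hwS, hw⟩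
  refine ⟨⋃₀ Set.range T, S, ?_, ?_, hSlow, hwS, ?_, ?_⟩
  · intro p hp
    exact ⟨T 0, ⟨0, rfl⟩, hT2 ▸ hp⟩
  · refine PI.sUnion _ ?_ (Set.range_nonempty T) ?_
    · exact (IsChain.directedOn (hT1.isChain_range))
    · rintro _ ⟨n, rfl⟩; exact (hT3 n).1
  · ext x
    constructor
    · rintro ⟨p, ⟨_, ⟨n, rfl⟩, hp⟩, rfl⟩
      obtain ⟨_, _, _, η, hη, q⟩ := hT3 n
      exact hSlow (q p hp).1 hη
    · intro hx
      obtain ⟨b, n, h⟩ := hT4 x hx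
      exact ⟨(x, b), ⟨T n, ⟨n, rfl⟩, h⟩, rfl⟩
  · ext x
    constructor
    · rintro ⟨p, ⟨_, ⟨n, rfl⟩, hp⟩, rfl⟩
      obtain ⟨_, _, _, η, hη, q⟩ := hT3 n
      exact hSlow (q p hp).2 hη
    · intro hx
      obtain ⟨a, n, h⟩ := hT5 x hx
      exact ⟨(a, x), ⟨T n, ⟨n, rfl⟩, h⟩, rfl⟩

theorem total {W : Type} [LinearOrder W] [Nonempty W] {L : W × ℕ → Set (Finset (W × ℕ))}
    (hL : GoodL L) (hc : ∀ w : W, (Set.Iio w).Countable) (hub : ∀ w : W, ∃ v, w < v)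
    (s : ℕ) (G0 : Set ((W × ℕ) × (W × ℕ))) (hG : PI (RR L) s G0) (hfin : G0.Finite) :
    ∃ G : Set ((W × ℕ) × (W × ℕ)), G0 ⊆ G ∧ PI (RR L) s G ∧
      Prod.fst '' G = Set.univ ∧ Prod.snd '' G = Set.univ := by
  obtain ⟨w, hw⟩ : ∃ w : W, ∀ p ∈ G0, p.1.1 ≤ w ∧ p.2.1 ≤ w := by
    obtain ⟨w1, h1⟩ := (hfin.image (fun p => p.1.1)).bddAbove
    obtain ⟨w2, h2⟩ := (hfin.image (fun p => p.2.1)).bddAbove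
    exact ⟨max w1 w2, fun p hp => ⟨(h1 ⟨p, hp, rfl⟩).trans (le_max_left _ _),
      (h2 ⟨p, hp, rfl⟩).trans (le_max_right _ _)⟩⟩
  obtain ⟨G1, S1, a1, a2, a3, a4, a5, a6⟩ := step hL hc hub s G0 hG
    (Good.of_finite _ _ (hfin.image _)) (Good.of_finite _ _ (hfin.image _)) w hw
  obtain ⟨G, hG1, hmax⟩ := zorn_subset_nonempty
    {G | PI (RR L) s G ∧ ∃ S : Set W, IsLowerSet S ∧ Prod.fst '' G = {x | x.1 ∈ S} ∧
      Prod.snd '' G = {x | x.1 ∈ S}} (by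
    intro c hcS hch hne
    refine ⟨⋃₀ c, ⟨?_, ?_⟩, fun s hs => Set.subset_sUnion_of_mem hs⟩
    · exact PI.sUnion c hch.directedOn hne (fun G hG => (hcS hG).1)
    · choose! S hS using fun G (hG : G ∈ c) => (hcS hG).2
      refine ⟨⋃ G ∈ c, S G, isLowerSet_iUnion₂ (fun G hG => (hS G hG).1), ?_, ?_⟩
      · rw [Set.sUnion_eq_biUnion, Set.image_iUnion₂]
        rw [Set.iUnion₂_congr (fun G hG => (hS G hG).2.1)]
        ext x; simp
      · rw [Set.sUnion_eq_biUnion, Set.image_iUnion₂]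
        rw [Set.iUnion₂_congr (fun G hG => (hS G hG).2.2)]
        ext x; simp) G1 ⟨a2, S1, a3, a5, a6⟩
  obtain ⟨⟨hPI, S, hS, b1, b2⟩, hm⟩ := hmax
  have hSu : ∀ w, w ∈ S := by
    by_contra! hne
    obtain ⟨w, hw⟩ := hne
    have hlt : ∀ v ∈ S, v ≤ w := fun v hv => by
      by_contra! h
      exact hw (hS h.le hv)
    obtain ⟨G2, S2, c1, c2, c3, c4, c5, c6⟩ := step hL hc hub s G hPI
      (by rw [b1]; exact Good.of_lower hL s S hS) (by rw [b2]; exact Good.of_lower hL s S hS) w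
      (fun p hp => ⟨hlt _ (show p.1 ∈ {x : W × ℕ | x.1 ∈ S} from b1 ▸ ⟨p, hp, rfl⟩),
        hlt _ (show p.2 ∈ {x : W × ℕ | x.1 ∈ S} from b2 ▸ ⟨p, hp, rfl⟩)⟩)
    have := hm ⟨c2, S2, c3, c5, c6⟩ c1
    have h3 : ((w, 0) : W × ℕ) ∈ Prod.fst '' G2 := by rw [c5]; exact c4
    have h4 : ((w, 0) : W × ℕ) ∈ Prod.fst '' G := Set.image_mono this h3
    rw [b1] at h4
    exact hw h4
  refine ⟨G, a1.trans hG1, hPI, ?_, ?_⟩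
  · rw [b1]; ext x; simp [hSu]
  · rw [b2]; ext x; simp [hSu]

theorem exists_perm {A : Type} [DecidableEq A] (R : Set (Finset A)) (s : ℕ) (G : Set (A × A))
    (h : PI R s G) (h1 : Prod.fst '' G = Set.univ) (h2 : Prod.snd '' G = Set.univ) :
    ∃ g : Equiv.Perm A, (∀ p ∈ G, g p.1 = p.2) ∧
      ∀ e : Finset A, e.card ≤ s → (e ∈ R ↔ e.image g ∈ R) := by
  have e1 : ∀ a, ∃ b, (a, b) ∈ G := by
    intro a
    have : a ∈ Prod.fst '' G := h1 ▸ trivial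
    obtain ⟨p, hp, rfl⟩ := this
    exact ⟨p.2, hp⟩
  have e2 : ∀ b, ∃ a, (a, b) ∈ G := by
    intro a
    have : a ∈ Prod.snd '' G := h2 ▸ trivial
    obtain ⟨p, hp, rfl⟩ := this
    exact ⟨p.1, hp⟩
  choose f hf using e1
  choose f' hf' using e2
  let g : Equiv.Perm A := ⟨f, f',
    fun a => (h.1 _ (hf' (f a)) _ (hf a)).2 rfl,
    fun b => (h.1 _ (hf (f' b)) _ (hf' b)).1 rfl⟩
  refine ⟨g, fun p hp => (h.1 _ (hf p.1) _ hp).1 rfl, ?_⟩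
  intro e he
  have := h.2 (e.image (fun a => (a, f a))) (by
    intro p hp
    simp only [Finset.coe_image] at hp
    obtain ⟨a, _, rfl⟩ := hp
    exact hf a) (Finset.card_image_le.trans he)
  rw [Finset.image_image, Finset.image_image] at this
  have h3 : (Prod.fst ∘ fun a => (a, f a)) = id := rfl
  rw [h3, Finset.image_id] at this
  exact this

end KK
namespace KK

theorem rigid {W : Type} [LinearOrder W] [WellFoundedLT W] {L : W × ℕ → Set (Finset (W × ℕ))}
    (hL : GoodL L) (hc : ∀ w : W, (Set.Iio w).Countable)
    (hbd : ∀ C : Set W, C.Countable → ∃ w, ∀ c ∈ C, c < w)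
    (g : Equiv.Perm (W × ℕ)) (hg : ∀ e : Finset (W × ℕ), e ∈ RR L ↔ e.image g ∈ RR L) :
    g = 1 := by
  have hub : ∀ w : W, ∃ t, w < t ∧ ∀ y : W × ℕ, y.1 ≤ w → (g y).1 < t ∧ (g.symm y).1 < t := by
    intro w
    have hI : {y : W × ℕ | y.1 ≤ w}.Countable := by
      have h1 : (Set.Iic w).Countable := by
        rw [← Set.Iio_insert]; exact (hc w).insert w
      have : {x : W × ℕ | x.1 ≤ w} = Set.Iic w ×ˢ Set.univ := by ext x; simp
      rw [this]
      exact h1.prod Set.countable_univ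
    obtain ⟨t, ht⟩ := hbd _ (((hI.image (fun y => (g y).1)).union
      (hI.image (fun y => (g.symm y).1))).union (Set.countable_singleton w))
    exact ⟨t, ht w (Or.inr rfl), fun y hy => ⟨ht _ (Or.inl (Or.inl ⟨y, hy, rfl⟩)),
      ht _ (Or.inl (Or.inr ⟨y, hy, rfl⟩))⟩⟩
  choose t ht ht' using hub
  ext1 x
  let S : Set W := {v | ∃ n : ℕ, v ≤ t^[n] x.1}
  have hSlow : IsLowerSet S := by
    rintro a b hab ⟨n, hn⟩
    exact ⟨n, hab.trans hn⟩
  have hSg : ∀ y : W × ℕ, y.1 ∈ S → (g y).1 ∈ S ∧ (g.symm y).1 ∈ S := by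
    rintro y ⟨n, hn⟩
    have := ht' _ y hn
    rw [← Function.iterate_succ_apply' t n] at this
    exact ⟨⟨n + 1, this.1.le⟩, ⟨n + 1, this.2.le⟩⟩
  have hSc : S.Countable := by
    have h1 : S ⊆ ⋃ n : ℕ, Set.Iio (t^[n+1] x.1) := by
      rintro v ⟨n, hn⟩
      refine Set.mem_iUnion.2 ⟨n, hn.trans_lt ?_⟩
      rw [Function.iterate_succ_apply']; exact ht _
    exact (Set.countable_iUnion (fun n => hc _)).mono h1
  obtain ⟨u, hu⟩ := hbd S hSc
  obtain ⟨w, hw⟩ : ∃ w, ∀ v, v ∈ S ↔ v < w := by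
    have hne : (Sᶜ).Nonempty := ⟨u, fun h => lt_irrefl _ (hu u h)⟩
    refine ⟨wellFounded_lt.min Sᶜ hne, fun v => ⟨fun hv => ?_, fun hv => ?_⟩⟩
    · by_contra! h
      exact wellFounded_lt.min_mem Sᶜ hne (hSlow h hv)
    · by_contra h
      exact wellFounded_lt.not_lt_min Sᶜ h hv
  have hxw : x.1 < w := (hw _).1 ⟨0, le_rfl⟩
  have hgw : ∀ y : W × ℕ, (g y).1 < w ↔ y.1 < w := by
    intro y
    rw [← hw, ← hw]
    refine ⟨fun h => ?_, fun h => (hSg y h).1⟩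
    simpa using (hSg _ h).2
  obtain ⟨p, hp, hq, f, hf, hLp⟩ := hL.special w ⟨_, hxw⟩
  let E : ℕ → Finset (W × ℕ) := fun k => (Finset.range k).image f
  have hfw : ∀ i, (f i).1 < w := by
    intro i
    have : f i ∈ Set.range f := ⟨i, rfl⟩
    rw [hf] at this; exact this
  have hE : ∀ k, ∀ y ∈ E k, y.1 < w := by
    intro k y hy
    obtain ⟨i, _, rfl⟩ := Finset.mem_image.1 hy
    exact hfw i
  have hgE : ∀ k, ∀ y ∈ (E k).image g, y.1 < w := by
    intro k y hy
    obtain ⟨z, hz, rfl⟩ := Finset.mem_image.1 hy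
    exact (hgw z).2 (hE k z hz)
  have hgp : w ≤ (g p).1 := by
    by_contra! h
    rw [hgw, hp] at h
    exact lt_irrefl _ h
  have hmem : ∀ k, (E k).image g ∈ L (g p) := by
    intro k
    have h1 : insert p (E k) ∈ RR L := (RR_top hL p (E k) (by rw [hp]; exact hE k)).2
      (by rw [hLp]; exact ⟨k, rfl⟩)
    rw [hg, Finset.image_insert, RR_top hL] at h1
    · exact h1
    · intro y hy
      exact (hgE k y hy).trans_le hgp
  have hinf : (Set.range (fun k => (E k).image g)).Infinite := by
    intro hfin
    have h1 : (⋃ e ∈ Set.range (fun k => (E k).image g), (e : Set (W × ℕ))).Finite :=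
      hfin.biUnion (fun e _ => e.finite_toSet)
    have h2 : (Set.range (fun n : ℕ => g (x.1, n))).Infinite :=
      Set.infinite_range_of_injective (fun a b h => by simpa using h)
    refine h2 (h1.subset ?_)
    rintro _ ⟨n, rfl⟩
    have : ((x.1, n) : W × ℕ) ∈ Set.range f := by rw [hf]; exact hxw
    obtain ⟨i, hi⟩ := this
    refine Set.mem_biUnion (⟨i + 1, rfl⟩) ?_
    simp only [Finset.mem_coe, ← hi]
    exact Finset.mem_image_of_mem _ (Finset.mem_image_of_mem _ (by simp))
  have hgpw : (g p).1 = w := by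
    refine (hgp.lt_or_eq.resolve_left ?_).symm
    intro hlt
    refine hinf ((hL.below (g p) w hlt).subset ?_)
    rintro _ ⟨k, rfl⟩
    exact ⟨hmem k, hgE k⟩
  have hfix : g p = p := by
    by_contra hne
    refine hinf ((hq _ hgpw hne).subset ?_)
    rintro _ ⟨k, rfl⟩
    exact hmem k
  have hEfix : ∀ k, (E k).image g = E k := by
    intro k
    have h1 := hmem k
    rw [hfix, hLp] at h1
    obtain ⟨j, hj⟩ := h1
    have hj : E j = (E k).image g := hj
    have hcard : ((E k).image g).card = (E k).card := Finset.card_image_of_injective _ g.injective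
    rw [← hj] at hcard ⊢
    rcases le_total j k with h | h
    · exact Finset.eq_of_subset_of_card_le
        (Finset.image_subset_image (Finset.range_mono h)) hcard.ge
    · exact (Finset.eq_of_subset_of_card_le
        (Finset.image_subset_image (Finset.range_mono h)) hcard.le).symm
  have hffix : ∀ k, g (f k) = f k := by
    intro k
    induction k using Nat.strong_induction_on with
    | _ k ih =>
      have h1 : g (f k) ∈ E (k + 1) := by
        rw [← hEfix]
        exact Finset.mem_image_of_mem _ (Finset.mem_image_of_mem _ (by simp))
      obtain ⟨j, hj, hj'⟩ := Finset.mem_image.1 h1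
      rw [Finset.mem_range] at hj
      rcases Nat.lt_succ_iff_lt_or_eq.1 hj with h | h
      · have h2 := ih j h
        rw [← h2] at hj'
        have := g.injective hj'
        rw [← this, h2]
      · rw [← hj', h]
  have : x ∈ Set.range f := by rw [hf]; exact hxw
  obtain ⟨i, hi⟩ := this
  rw [← hi]
  exact hffix i

theorem core : ∃ (A : Type) (_ : DecidableEq A) (R : Set (Finset A)),
    Cardinal.mk A = Cardinal.aleph 1 ∧ ∅ ∉ R ∧
    (∀ (s : ℕ) (X : Set A), X.Finite → ∀ f : A → A, Set.InjOn f X →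
      (∀ e : Finset A, (e : Set A) ⊆ X → e.card ≤ s → (e ∈ R ↔ e.image f ∈ R)) →
      ∃ g : Equiv.Perm A, (∀ x ∈ X, g x = f x) ∧
        ∀ e : Finset A, e.card ≤ s → (e ∈ R ↔ e.image g ∈ R)) ∧
    (∀ g : Equiv.Perm A, (∀ e : Finset A, e ∈ R ↔ e.image g ∈ R) → g = 1) := by
  let W : Type := (Cardinal.aleph 1).ord.ToType
  have hW : Cardinal.mk W = Cardinal.aleph 1 := Cardinal.mk_ord_toType _
  have hc : ∀ w : W, (Set.Iio w).Countable := by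
    intro w
    rw [← Cardinal.le_aleph0_iff_set_countable]
    have h := Cardinal.mk_Iio_lt w (by rw [hW]; simp [W])
    exact Order.lt_succ_iff.1 (h.trans_eq (hW.trans Cardinal.succ_aleph0.symm))
  have hbd : ∀ C : Set W, C.Countable → ∃ w, ∀ c ∈ C, c < w := by
    intro C hC
    by_contra! h
    have : (Set.univ : Set W) ⊆ ⋃ c ∈ C, Set.Iic c := by
      intro w _
      obtain ⟨c, hc, hw⟩ := h w
      exact Set.mem_biUnion hc hw
    have h1 : (Set.univ : Set W).Countable := (hC.biUnion (fun c _ => by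
      rw [← Set.Iio_insert]; exact (hc c).insert c)).mono this
    rw [← Cardinal.le_aleph0_iff_set_countable, Cardinal.mk_univ, hW] at h1
    exact absurd h1 (not_le.2 Cardinal.aleph0_lt_aleph_one)
  have hub : ∀ w : W, ∃ v, w < v := fun w => by
    obtain ⟨v, hv⟩ := hbd {w} (Set.countable_singleton w)
    exact ⟨v, hv w rfl⟩
  obtain ⟨w0, -⟩ := hbd ∅ Set.countable_empty
  have : Nonempty W := ⟨w0⟩
  obtain ⟨L, hL⟩ := exists_L W hc
  refine ⟨W × ℕ, inferInstance, RR L, ?_, ?_, ?_, ?_⟩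
  · simp only [Cardinal.mk_prod, Cardinal.lift_id, hW, Cardinal.mk_nat]
    exact Cardinal.mul_aleph0_eq (Cardinal.aleph0_le_aleph 1)
  · rintro ⟨p, hp, _⟩
    simp at hp
  · intro s X hX f hf hpres
    obtain ⟨G, h1, h2, h3, h4⟩ := total hL hc hub s ((fun x => (x, f x)) '' X) (by
      constructor
      · rintro _ ⟨a, ha, rfl⟩ _ ⟨b, hb, rfl⟩
        exact ⟨fun h => congrArg f h, fun h => hf ha hb h⟩
      · intro e he hs
        have h5 : e.image Prod.snd = (e.image Prod.fst).image f := by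
          rw [Finset.image_image]
          refine Finset.image_congr ?_
          intro p hp
          obtain ⟨a, _, rfl⟩ := he hp
          rfl
        rw [h5]
        refine hpres _ ?_ (Finset.card_image_le.trans hs)
        intro x hx
        simp only [Finset.coe_image] at hx
        obtain ⟨p, hp, rfl⟩ := hx
        obtain ⟨a, ha, rfl⟩ := he hp
        exact ha) (hX.image _)
    obtain ⟨g, hg1, hg2⟩ := exists_perm _ s G h2 h3 h4
    exact ⟨g, fun x hx => hg1 _ (h1 ⟨x, hx, rfl⟩), hg2⟩
  · exact fun g hg => rigid hL hc hbd g hg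

end KK
namespace KK

theorem permImage_eq_iff {A : Type} (g : Equiv.Perm A) {m : ℕ} (σ : Set (Fin m → A)) :
    permImage g σ = σ ↔ ∀ a, a ∈ σ ↔ ⇑g ∘ a ∈ σ := by
  constructor
  · intro h a
    constructor
    · intro ha
      rw [← h]; exact ⟨a, ha, rfl⟩
    · intro ha
      rw [← h] at ha
      obtain ⟨b, hb, hab⟩ := ha
      have : b = a := g.injective.comp_left hab
      exact this ▸ hb
  · intro h
    ext a
    constructor
    · rintro ⟨b, hb, rfl⟩
      exact (h b).1 hb
    · intro ha
      have h1 : ⇑g ∘ (⇑g.symm ∘ a) = a := by funext i; simp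
      refine ⟨⇑g.symm ∘ a, (h _).2 ?_, h1⟩
      rw [h1]; exact ha

abbrev QQ {A : Type} (ρ : ∀ k : ℕ, Set (Fin (k + 1) → A)) (s : ℕ) : Set (Rels A) :=
  {r : Rels A | ∃ k, k < s ∧ r = ⟨k, ρ k⟩}

abbrev QA {A : Type} (ρ : ∀ k : ℕ, Set (Fin (k + 1) → A)) : Set (Rels A) :=
  {r : Rels A | ∃ k, r = ⟨k, ρ k⟩}

theorem mem_AutR_QQ {A : Type} (ρ : ∀ k : ℕ, Set (Fin (k + 1) → A)) (s : ℕ) (g : Equiv.Perm A) :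
    g ∈ AutR (QQ ρ s) ↔ ∀ k < s, ∀ a, a ∈ ρ k ↔ ⇑g ∘ a ∈ ρ k := by
  constructor
  · intro h k hk
    exact (permImage_eq_iff g _).1 (h ⟨k, ρ k⟩ ⟨k, hk, rfl⟩)
  · rintro h _ ⟨k, hk, rfl⟩
    exact (permImage_eq_iff g _).2 (h k hk)

theorem mem_AutR_QA {A : Type} (ρ : ∀ k : ℕ, Set (Fin (k + 1) → A)) (g : Equiv.Perm A) :
    g ∈ AutR (QA ρ) ↔ ∀ k, ∀ a, a ∈ ρ k ↔ ⇑g ∘ a ∈ ρ k := by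
  constructor
  · intro h k
    exact (permImage_eq_iff g _).1 (h ⟨k, ρ k⟩ ⟨k, rfl⟩)
  · rintro h _ ⟨k, rfl⟩
    exact (permImage_eq_iff g _).2 (h k)

theorem exists_enum {A : Type} [DecidableEq A] (e : Finset A) (he : e.Nonempty) :
    ∃ k, k + 1 = e.card ∧ ∃ a : Fin (k + 1) → A, Function.Injective a ∧
      Finset.univ.image a = e := by
  obtain ⟨k, hk⟩ : ∃ k, e.card = k + 1 := ⟨e.card - 1, by have := he.card_pos; omega⟩
  let eq := e.equivFinOfCardEq hk
  refine ⟨k, hk.symm, fun i => (eq.symm i).1, ?_, ?_⟩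
  · intro i j h
    exact eq.symm.injective (Subtype.ext h)
  · ext x
    simp only [Finset.mem_image, Finset.mem_univ, true_and]
    constructor
    · rintro ⟨i, rfl⟩; exact (eq.symm i).2
    · intro hx
      exact ⟨eq ⟨x, hx⟩, by simp⟩

theorem core2 : ∃ (A : Type) (ρ : ∀ k : ℕ, Set (Fin (k + 1) → A)),
    Cardinal.mk A = Cardinal.aleph 1 ∧ (∀ k, ∀ a ∈ ρ k, Function.Injective a) ∧
    (∀ s, Homogeneous (QQ ρ s)) ∧ AutR (QA ρ) = {1} := by
  obtain ⟨A, dec, R, hA, h0, hhom, hrig⟩ := core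
  let ρ : ∀ k : ℕ, Set (Fin (k + 1) → A) := fun k =>
    {a | Function.Injective a ∧ Finset.univ.image a ∈ R}
  refine ⟨A, ρ, hA, fun k a ha => ha.1, ?_, ?_⟩
  · rintro s X hX f ⟨hf, hpa⟩
    obtain ⟨g, hg1, hg2⟩ := hhom s X hX f hf (by
      intro e heX hes
      rcases e.eq_empty_or_nonempty with rfl | hne
      · simp
      obtain ⟨k, hk, a, ha, rfl⟩ := exists_enum e hne
      have haX : ∀ i, a i ∈ X := fun i => heX (by simp)
      have h1 := hpa ⟨k, ρ k⟩ ⟨k, by omega, rfl⟩ a haX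
      have hfa : Function.Injective (f ∘ a) := fun i j h => ha (hf (haX i) (haX j) h)
      have h2 : a ∈ ρ k ↔ f ∘ a ∈ ρ k := h1
      rw [Finset.image_image]
      exact ⟨fun h => (h2.1 ⟨ha, h⟩).2, fun h => (h2.2 ⟨hfa, h⟩).2⟩)
    refine ⟨g, (mem_AutR_QQ ρ s g).2 ?_, hg1⟩
    intro k hk a
    have := hg2 (Finset.univ.image a) (Finset.card_image_le.trans (by simp; omega))
    rw [Finset.image_image] at this
    exact and_congr (g.injective.of_comp_iff a).symm this
  · ext g
    rw [mem_AutR_QA]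
    constructor
    · intro h
      refine hrig g ?_
      intro e
      rcases e.eq_empty_or_nonempty with rfl | hne
      · simp
      obtain ⟨k, hk, a, ha, rfl⟩ := exists_enum e hne
      have h2 := h k a
      rw [Finset.image_image]
      exact ⟨fun h => (h2.1 ⟨ha, h⟩).2, fun h => (h2.2 ⟨g.injective.comp ha, h⟩).2⟩
    · rintro rfl k a
      exact Iff.rfl

def ST {M N : Type} (rM : ∀ k : ℕ, Set (Fin (k + 1) → M)) (rN : ∀ k : ℕ, Set (Fin (k + 1) → N))
    {n : ℕ} (a : Fin n → M) (b : Fin n → N) : Prop :=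
  (∀ i j, a i = a j ↔ b i = b j) ∧
    ∀ k < n, ∀ f : Fin (k + 1) → Fin n, a ∘ f ∈ rM k ↔ b ∘ f ∈ rN k

theorem ST.all {M N : Type} {rM : ∀ k : ℕ, Set (Fin (k + 1) → M)}
    {rN : ∀ k : ℕ, Set (Fin (k + 1) → N)} (hM : ∀ k, ∀ a ∈ rM k, Function.Injective a)
    (hN : ∀ k, ∀ a ∈ rN k, Function.Injective a)
    {n : ℕ} {a : Fin n → M} {b : Fin n → N} (h : ST rM rN a b) (k : ℕ) (f : Fin (k + 1) → Fin n) :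
    a ∘ f ∈ rM k ↔ b ∘ f ∈ rN k := by
  by_cases hk : k < n
  · exact h.2 k hk f
  · have : ¬ Function.Injective f := by
      intro hf
      have := Fintype.card_le_of_injective f hf
      simp at this
      omega
    exact iff_of_false (fun h => this (hM k _ h).of_comp) (fun h => this (hN k _ h).of_comp)

theorem ST.exists_aut {A : Type} {ρ : ∀ k : ℕ, Set (Fin (k + 1) → A)}
    (hinj : ∀ k, ∀ a ∈ ρ k, Function.Injective a) (hom : ∀ s, Homogeneous (QQ ρ s))
    {n : ℕ} {a b : Fin n → A} (h : ST ρ ρ a b) (s : ℕ) : ∃ g ∈ AutR (QQ ρ s), ⇑g ∘ a = b := by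
  classical
  have hex : ∃ F : A → A, ∀ i, F (a i) = b i := by
    refine ⟨fun x => if hx : ∃ i, a i = x then b hx.choose else x, fun i => ?_⟩
    have hx : ∃ j, a j = a i := ⟨i, rfl⟩
    simp only [hx, dite_true]
    exact (h.1 _ _).1 hx.choose_spec
  obtain ⟨F, hF⟩ := hex
  obtain ⟨g, hg, hgF⟩ := hom s (Set.range a) (Set.finite_range a) F (by
    constructor
    · rintro _ ⟨i, rfl⟩ _ ⟨j, rfl⟩ hij
      rw [hF, hF] at hij
      exact (h.1 i j).2 hij
    · rintro _ ⟨k, hk, rfl⟩ c hc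
      choose f hf using hc
      have h1 : c = a ∘ f := funext fun i => (hf i).symm
      have h2 : F ∘ c = b ∘ f := by
        rw [h1]; funext i; exact hF _
      rw [h2, h1]
      exact h.all hinj hinj k f)
  exact ⟨g, hg, funext fun i => (hgF _ ⟨i, rfl⟩).trans (hF i)⟩

theorem ST.of_aut {A : Type} {ρ : ∀ k : ℕ, Set (Fin (k + 1) → A)} {n : ℕ} (a : Fin n → A)
    {g : Equiv.Perm A} (hg : g ∈ AutR (QQ ρ n)) : ST ρ ρ a (⇑g ∘ a) :=
  ⟨fun i j => by simp, fun k hk f => (mem_AutR_QQ ρ n g).1 hg k hk (a ∘ f)⟩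

end KK
namespace KK

abbrev Ix (n : ℕ) : Type := (Fin n × Fin n) ⊕ (Σ k : Fin n, (Fin (k.val + 1) → Fin n))

def pat {A : Type} (rA : ∀ k : ℕ, Set (Fin (k + 1) → A)) {n : ℕ} (a : Fin n → A) : Ix n → Prop
  | Sum.inl p => a p.1 = a p.2
  | Sum.inr q => a ∘ q.2 ∈ rA q.1.val

theorem pat_iff {M N : Type} (rM : ∀ k : ℕ, Set (Fin (k + 1) → M))
    (rN : ∀ k : ℕ, Set (Fin (k + 1) → N)) {n : ℕ} (a : Fin n → M) (b : Fin n → N) :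
    (∀ i, pat rM a i ↔ pat rN b i) ↔ ST rM rN a b := by
  constructor
  · intro h
    exact ⟨fun i j => h (Sum.inl (i, j)), fun k hk f => h (Sum.inr ⟨⟨k, hk⟩, f⟩)⟩
  · rintro ⟨h1, h2⟩ (⟨i, j⟩ | ⟨⟨k, hk⟩, f⟩)
    · exact h1 i j
    · exact h2 k hk f

theorem patF {L : FirstOrder.Language.{0, 0}} {n : ℕ} (R : ∀ k : Fin n, L.Relations (k.val + 1))
    (c : Ix n → Prop) :
    ∃ φ : L.Formula (Fin n), ∀ (N : Type) [L.Structure N] (rN : ∀ k : ℕ, Set (Fin (k + 1) → N)),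
      (∀ k : Fin n, ∀ x, Language.Structure.RelMap (R k) x ↔ x ∈ rN k.val) →
      ∀ b : Fin n → N, φ.Realize b ↔ ∀ i, c i ↔ pat rN b i := by
  classical
  let atm : Ix n → L.Formula (Fin n) := fun i => match i with
    | Sum.inl p => (Language.Term.var p.1).equal (Language.Term.var p.2)
    | Sum.inr q => (R q.1).formula (fun j => Language.Term.var (q.2 j))
  refine ⟨Language.Formula.iInf (fun i => if c i then atm i else (atm i).not), ?_⟩
  intro N _ rN hR b
  rw [Language.Formula.realize_iInf]
  refine forall_congr' fun i => ?_
  have key : (atm i).Realize b ↔ pat rN b i := by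
    rcases i with ⟨i, j⟩ | ⟨k, f⟩
    · simp [atm, pat]
    · simp only [atm, pat, Language.Formula.realize_rel]
      exact hR k _
  rw [← key]
  by_cases h : c i
  · simp [h]
  · simp [h]

theorem typeST {L : FirstOrder.Language.{0, 0}} {n : ℕ} (R : ∀ k : Fin n, L.Relations (k.val + 1))
    {A : Type} (rA : ∀ k : ℕ, Set (Fin (k + 1) → A)) (T : Set (Fin n → A)) :
    ∃ φ : L.Formula (Fin n), ∀ (N : Type) [L.Structure N] (rN : ∀ k : ℕ, Set (Fin (k + 1) → N)),
      (∀ k : Fin n, ∀ x, Language.Structure.RelMap (R k) x ↔ x ∈ rN k.val) →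
      ∀ b : Fin n → N, φ.Realize b ↔ ∃ a ∈ T, ST rA rN a b := by
  choose F hF using patF R
  refine ⟨Language.Formula.iSup (fun c : {c : Ix n → Prop // ∃ a ∈ T, c = pat rA a} => F c.1), ?_⟩
  intro N _ rN hR b
  rw [Language.Formula.realize_iSup]
  constructor
  · rintro ⟨⟨_, a, ha, rfl⟩, h⟩
    exact ⟨a, ha, (pat_iff _ _ _ _).1 ((hF _ N rN hR b).1 h)⟩
  · rintro ⟨a, ha, h⟩
    exact ⟨⟨_, a, ha, rfl⟩, (hF _ N rN hR b).2 ((pat_iff _ _ _ _).2 h)⟩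

theorem AutR_symm {A : Type} {Q : Set (Rels A)} {g : Equiv.Perm A} (hg : g ∈ AutR Q) :
    g.symm ∈ AutR Q := by
  intro r hr
  have h := (permImage_eq_iff g r.2).1 (hg r hr)
  rw [permImage_eq_iff]
  intro a
  rw [h (⇑g.symm ∘ a)]
  have : ⇑g ∘ (⇑g.symm ∘ a) = a := by funext i; simp
  rw [this]

def K0 {A : Type} (ρ : ∀ k : ℕ, Set (Fin (k + 1) → A)) : Set (Rels A) :=
  {r | ∀ g ∈ AutR (QQ ρ (r.1 + 1)), permImage g r.2 = r.2}

theorem QQ_mono {A : Type} (ρ : ∀ k : ℕ, Set (Fin (k + 1) → A)) {s t : ℕ} (h : s ≤ t) :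
    AutR (QQ ρ t) ⊆ AutR (QQ ρ s) := by
  rintro g hg _ ⟨k, hk, rfl⟩
  exact hg ⟨k, ρ k⟩ ⟨k, by omega, rfl⟩

theorem K0_of {A : Type} {ρ : ∀ k : ℕ, Set (Fin (k + 1) → A)}
    (hinj : ∀ k, ∀ a ∈ ρ k, Function.Injective a) (hom : ∀ s, Homogeneous (QQ ρ s))
    (s : ℕ) {m : ℕ} (σ : Set (Fin (m + 1) → A))
    (h : ∀ g ∈ AutR (QQ ρ s), permImage g σ = σ) : (⟨m, σ⟩ : Rels A) ∈ K0 ρ := by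
  intro g hg
  change g ∈ AutR (QQ ρ (m + 1)) at hg
  change permImage g σ = σ
  rw [permImage_eq_iff]
  intro a
  obtain ⟨g', hg', e⟩ := (ST.of_aut a hg).exists_aut hinj hom s
  rw [← e]
  exact (permImage_eq_iff g' σ).1 (h g' hg') a

theorem QA_sub_K0 {A : Type} (ρ : ∀ k : ℕ, Set (Fin (k + 1) → A)) : QA ρ ⊆ K0 ρ := by
  rintro _ ⟨k, rfl⟩ g hg
  exact hg ⟨k, ρ k⟩ ⟨k, Nat.lt_succ_self k, rfl⟩

theorem K0_inv {A : Type} {ρ : ∀ k : ℕ, Set (Fin (k + 1) → A)}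
    (hinj : ∀ k, ∀ a ∈ ρ k, Function.Injective a) (hom : ∀ s, Homogeneous (QQ ρ s)) :
    InvClosed (K0 ρ) := by
  intro n k m F hF r hr
  refine K0_of hinj hom (Finset.univ.sup (fun i => k i + 1)) _ ?_
  intro g hg
  rw [← hF g r]
  congr 1
  funext i
  exact hr i g (QQ_mono ρ (Finset.le_sup (f := fun i => k i + 1) (Finset.mem_univ i)) hg)

theorem K0_inter {A : Type} (ρ : ∀ k : ℕ, Set (Fin (k + 1) → A)) : InterClosed (K0 ρ) := by
  constructor
  · intro m g hg
    exact (permImage_eq_iff g Set.univ).2 (by simp)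
  · intro m Q hQ g hg
    refine (permImage_eq_iff g (⋂₀ Q)).2 fun a => ?_
    simp only [Set.mem_sInter]
    exact forall₂_congr fun σ hσ => (permImage_eq_iff g σ).1 (hQ σ hσ g hg) a

theorem K0_sub_KA {A : Type} {ρ : ∀ k : ℕ, Set (Fin (k + 1) → A)}
    (hinj : ∀ k, ∀ a ∈ ρ k, Function.Injective a) (hom : ∀ s, Homogeneous (QQ ρ s)) :
    K0 ρ ⊆ KAClosure (QA ρ) := by
  rintro ⟨m, σ⟩ hσ R ⟨hR1, hR2⟩
  obtain ⟨φ, hφ⟩ := typeST (L := relLang (m + 1) (fun i => i.val + 1))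
    (n := m + 1) (fun k => ⟨k, rfl⟩) ρ σ
  have h := hR2 (m + 1) (fun i => i.val) (fun i => ρ i.val) (fun i => hR1 ⟨i.val, rfl⟩) m φ
  have e : logicalOp (fun i : Fin (m + 1) => ρ i.val) φ = σ := by
    letI := relStruct (fun i : Fin (m + 1) => ρ i.val)
    ext b
    refine (hφ A ρ (fun k x => Iff.rfl) b).trans ?_
    constructor
    · rintro ⟨a, ha, hab⟩
      obtain ⟨g, hg, e⟩ := hab.exists_aut hinj hom (m + 1)
      rw [← e]
      exact ((permImage_eq_iff g σ).1 (hσ g hg) a).1 ha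
    · intro hb
      exact ⟨b, hb, fun _ _ => Iff.rfl, fun _ _ _ => Iff.rfl⟩
  rw [e] at h
  exact h

theorem logicalOp_tr {A B : Type} {n : ℕ} {k : Fin n → ℕ} {m : ℕ}
    (φ : (relLang n k).Formula (Fin m)) (g : A ≃ B) (ρ : ∀ i : Fin n, Set (Fin (k i) → A))
    (ρ' : ∀ i : Fin n, Set (Fin (k i) → B)) (h : ∀ i x, x ∈ ρ i ↔ ⇑g ∘ x ∈ ρ' i) (a : Fin m → A) :
    a ∈ logicalOp ρ φ ↔ ⇑g ∘ a ∈ logicalOp ρ' φ := by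
  letI i1 : (relLang n k).Structure A := relStruct ρ
  letI i2 : (relLang n k).Structure B := relStruct ρ'
  let e : A ≃[relLang n k] B :=
    { toEquiv := g
      map_fun' := fun f => f.elim
      map_rel' := fun r x => (h r.1 _).symm }
  exact (Language.StrongHomClass.realize_formula e φ (v := a)).symm

theorem logicalOp_inv {A : Type} {n : ℕ} {k : Fin n → ℕ} {m : ℕ}
    (φ : (relLang n k).Formula (Fin m)) (g : Equiv.Perm A) (ρ : ∀ i : Fin n, Set (Fin (k i) → A)) :
    logicalOp (fun i => permImage g (ρ i)) φ = permImage g (logicalOp ρ φ) := by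
  have key := logicalOp_tr φ g ρ (fun i => permImage g (ρ i)) (by
    intro i x
    constructor
    · intro h
      exact ⟨_, h, rfl⟩
    · rintro ⟨y, hy, hxy⟩
      have : y = x := g.injective.comp_left hxy
      exact this ▸ hy)
  ext b
  constructor
  · intro hb
    have h1 : ⇑g ∘ (⇑g.symm ∘ b) = b := by funext i; simp
    refine ⟨⇑g.symm ∘ b, (key _).2 ?_, h1⟩
    rw [h1]; exact hb
  · rintro ⟨a, ha, rfl⟩
    exact (key a).1 ha

theorem KA_of_inv {A : Type} {R : Set (Rels A)} (h : InvClosed R) : KrasnerClosed R := by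
  intro n k ρ hρ m φ
  exact h n k m (fun ρ => logicalOp ρ φ) (fun g ρ => logicalOp_inv φ g ρ) ρ hρ

theorem inv_eq_K0 {A : Type} {ρ : ∀ k : ℕ, Set (Fin (k + 1) → A)}
    (hinj : ∀ k, ∀ a ∈ ρ k, Function.Injective a) (hom : ∀ s, Homogeneous (QQ ρ s)) :
    KAClosure (QA ρ) = K0 ρ ∧ invInterClosure (QA ρ) = K0 ρ := by
  have h1 := K0_sub_KA hinj hom
  have h2 : KAClosure (QA ρ) ⊆ invInterClosure (QA ρ) := by
    rintro r hr R ⟨h1, h2, h3⟩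
    exact hr R ⟨h1, KA_of_inv h2⟩
  have h3 : invInterClosure (QA ρ) ⊆ K0 ρ := fun r hr =>
    hr _ ⟨QA_sub_K0 ρ, K0_inv hinj hom, K0_inter ρ⟩
  exact ⟨(h2.trans h3).antisymm h1, h3.antisymm (h1.trans h2)⟩

theorem K0_ne {A : Type} [Infinite A] {ρ : ∀ k : ℕ, Set (Fin (k + 1) → A)}
    (hinj : ∀ k, ∀ a ∈ ρ k, Function.Injective a) (hom : ∀ s, Homogeneous (QQ ρ s)) :
    K0 ρ ≠ Set.univ := by
  intro h
  obtain ⟨x, y, hxy, hh⟩ := Finite.exists_ne_map_eq_of_infinite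
    (fun x : A => ((fun _ => x : Fin (0 + 1) → A) ∈ ρ 0))
  have hst : ST ρ ρ (fun _ : Fin 1 => x) (fun _ : Fin 1 => y) := by
    refine ⟨fun i j => by simp, fun k hk f => ?_⟩
    obtain rfl : k = 0 := by omega
    exact iff_of_eq hh
  obtain ⟨g, hg, e⟩ := hst.exists_aut hinj hom 1
  have hm : (⟨0, {fun _ => x}⟩ : Rels A) ∈ K0 ρ := h ▸ Set.mem_univ _
  have h1 := ((permImage_eq_iff g {fun _ => x}).1 (hm g hg) (fun _ => x)).1 rfl
  rw [e] at h1
  exact hxy (congrFun h1 0).symm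

end KK
namespace KK

def rl (M : Type) [Lrel.Structure M] (k : ℕ) : Set (Fin (k + 1) → M) :=
  {x | Language.Structure.RelMap (L := Lrel) (⟨k, rfl⟩ : Lrel.Relations (k + 1)) x}

theorem transfer (A M : Type) [Lrel.Structure A] [Lrel.Structure M]
    (hM : M ⊨ Lrel.completeTheory A) {n : ℕ} (φ : Lrel.Formula (Fin n)) :
    (∀ v : Fin n → M, φ.Realize v) ↔ (∀ v : Fin n → A, φ.Realize v) := by
  let ψ : Lrel.Sentence := Language.Formula.iAlls (α := Empty) (Fin n) (φ.relabel Sum.inr)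
  have h := Language.realize_iff_of_model_completeTheory (L := Lrel) A M ψ
  have h1 : ∀ (X : Type) [Lrel.Structure X], (X ⊨ ψ) ↔ ∀ v : Fin n → X, φ.Realize v := by
    intro X _
    simp only [ψ, Language.Sentence.Realize, Language.Formula.realize_iAlls,
      Language.Formula.realize_relabel]
    rfl
  rw [h1, h1] at h
  exact h

theorem inj_tr (A M : Type) [Lrel.Structure A] [Lrel.Structure M]
    (hM : M ⊨ Lrel.completeTheory A) (hinj : ∀ k, ∀ a ∈ rl A k, Function.Injective a) :
    ∀ k, ∀ a ∈ rl M k, Function.Injective a := by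
  intro k a ha i j hij
  by_contra hne
  have h := (transfer A M hM ((Language.Relations.formula (L := Lrel)
    (⟨k, rfl⟩ : Lrel.Relations (k + 1)) (fun j => Language.Term.var j)).imp
      (((Language.Term.var i).equal (Language.Term.var j)).not))).2 (by
    intro v
    simp only [Language.Formula.realize_imp, Language.Formula.realize_rel,
      Language.Formula.realize_not, Language.Formula.realize_equal, Language.Term.realize_var]
    intro hv e
    exact hne (hinj k v hv e)) a
  simp only [Language.Formula.realize_imp, Language.Formula.realize_rel,
      Language.Formula.realize_not, Language.Formula.realize_equal, Language.Term.realize_var] at h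
  exact h ha hij

theorem ST.symm {M N : Type} {rM : ∀ k : ℕ, Set (Fin (k + 1) → M)}
    {rN : ∀ k : ℕ, Set (Fin (k + 1) → N)} {n : ℕ} {a : Fin n → M} {b : Fin n → N}
    (h : ST rM rN a b) : ST rN rM b a :=
  ⟨fun i j => (h.1 i j).symm, fun k hk f => (h.2 k hk f).symm⟩

theorem ST.trans {M N P : Type} {rM : ∀ k : ℕ, Set (Fin (k + 1) → M)}
    {rN : ∀ k : ℕ, Set (Fin (k + 1) → N)} {rP : ∀ k : ℕ, Set (Fin (k + 1) → P)}
    {n : ℕ} {a : Fin n → M} {b : Fin n → N} {c : Fin n → P}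
    (h : ST rM rN a b) (h' : ST rN rP b c) : ST rM rP a c :=
  ⟨fun i j => (h.1 i j).trans (h'.1 i j), fun k hk f => (h.2 k hk f).trans (h'.2 k hk f)⟩

/-- every type realized in `M` is realized in `A` -/
theorem real_tr (A M : Type) [Lrel.Structure A] [Lrel.Structure M]
    (hM : M ⊨ Lrel.completeTheory A) {n : ℕ} (a : Fin n → M) :
    ∃ b : Fin n → A, ST (rl M) (rl A) a b := by
  by_contra hcon
  push Not at hcon
  obtain ⟨φ, hφ⟩ := typeST (L := Lrel) (n := n) (fun k => ⟨k.val, rfl⟩) (rl M) {a}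
  have h := (transfer A M hM φ.not).2 (by
    intro v
    rw [Language.Formula.realize_not, hφ A (rl A) (fun k x => Iff.rfl)]
    rintro ⟨_, rfl, h⟩
    exact hcon v h) a
  rw [Language.Formula.realize_not, hφ M (rl M) (fun k x => Iff.rfl)] at h
  exact h ⟨a, rfl, fun _ _ => Iff.rfl, fun _ _ _ => Iff.rfl⟩

theorem ST.restrict {M N : Type} {rM : ∀ k : ℕ, Set (Fin (k + 1) → M)}
    {rN : ∀ k : ℕ, Set (Fin (k + 1) → N)} {n p : ℕ} {a : Fin n → M} {b : Fin n → N}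
    (hM : ∀ k, ∀ a ∈ rM k, Function.Injective a)
    (hN : ∀ k, ∀ a ∈ rN k, Function.Injective a)
    (h : ST rM rN a b) (f : Fin p → Fin n) : ST rM rN (a ∘ f) (b ∘ f) :=
  ⟨fun i j => h.1 _ _, fun k _ f' => h.all hM hN k (f ∘ f')⟩

theorem ext_tr (A M N : Type) [Lrel.Structure A] [Lrel.Structure M] [Lrel.Structure N]
    (hM : M ⊨ Lrel.completeTheory A) (hN : N ⊨ Lrel.completeTheory A)
    (hinj : ∀ k, ∀ a ∈ rl A k, Function.Injective a) (hom : ∀ s, Homogeneous (QQ (rl A) s))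
    {n : ℕ} (a : Fin n → M) (b : Fin n → N) (hab : ST (rl M) (rl N) a b) (c : M) :
    ∃ d : N, ST (rl M) (rl N) (Fin.snoc a c : Fin (n + 1) → M) (Fin.snoc b d : Fin (n + 1) → N) := by
  have hMi := inj_tr A M hM hinj
  have hNi := inj_tr A N hN hinj
  obtain ⟨e, he⟩ := real_tr A M hM (Fin.snoc a c : Fin (n + 1) → M)
  obtain ⟨τ, hτ⟩ := typeST (L := Lrel) (n := n + 1) (fun k => ⟨k.val, rfl⟩) (rl A) {e}
  obtain ⟨σ, hσ⟩ := typeST (L := Lrel) (n := n) (fun k => ⟨k.val, rfl⟩) (rl A) {e ∘ Fin.castSucc}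
  have hae : ST (rl M) (rl A) a (e ∘ Fin.castSucc) := by
    have := he.restrict hMi hinj Fin.castSucc
    have h2 : (Fin.snoc a c : Fin (n + 1) → M) ∘ Fin.castSucc = a := by funext i; simp
    rwa [h2] at this
  let re : Fin (n + 1) → Fin n ⊕ Unit := fun i => Fin.lastCases (Sum.inr ()) (fun j => Sum.inl j) i
  have hre : ∀ (X : Type) (v : Fin n → X) (w : Unit → X),
      Sum.elim v w ∘ re = (Fin.snoc v (w ()) : Fin (n + 1) → X) := by
    intro X v w
    funext i
    refine Fin.lastCases ?_ (fun j => ?_) i <;> simp [re]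
  have hψ : ∀ (X : Type) [Lrel.Structure X] (v : Fin n → X),
      (σ.imp (Language.Formula.iExs Unit (τ.relabel re))).Realize v ↔
        (ST (rl A) (rl X) (e ∘ Fin.castSucc) v →
          ∃ w : X, ST (rl A) (rl X) e (Fin.snoc v w : Fin (n + 1) → X)) := by
    intro X _ v
    rw [Language.Formula.realize_imp, hσ X (rl X) (fun k x => Iff.rfl),
      Language.Formula.realize_iExs]
    simp only [Language.Formula.realize_relabel, hre, Set.mem_singleton_iff, exists_eq_left,
      hτ X (rl X) (fun k x => Iff.rfl)]
    exact imp_congr Iff.rfl ⟨fun ⟨i, h⟩ => ⟨_, h⟩, fun ⟨w, h⟩ => ⟨fun _ => w, h⟩⟩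
  have h := (hψ N b).1 ((transfer A N hN _).2 (by
    intro v
    rw [hψ]
    intro hv
    obtain ⟨g, hg, hge⟩ := hv.exists_aut hinj hom (n + 1)
    refine ⟨g (e (Fin.last n)), ?_⟩
    have h1 := ST.of_aut e hg
    have h2 : ⇑g ∘ e = (Fin.snoc v (g (e (Fin.last n))) : Fin (n + 1) → A) := by
      funext i
      refine Fin.lastCases ?_ (fun j => ?_) i
      · simp
      · simpa using congrFun hge j
    rwa [h2] at h1) b) (hae.symm.trans hab)
  obtain ⟨w, hw⟩ := h
  exact ⟨w, he.trans hw⟩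

def BQ (M N : Type) [Lrel.Structure M] [Lrel.Structure N] (G : Set (M × N)) : Prop :=
  ∃ (n : ℕ) (a : Fin n → M) (b : Fin n → N), ST (rl M) (rl N) a b ∧
    G = Set.range (fun i => (a i, b i))

theorem range_snoc {M N : Type} {n : ℕ} (a : Fin n → M) (b : Fin n → N) (c : M) (d : N) :
    Set.range (fun i => ((Fin.snoc a c : Fin (n + 1) → M) i, (Fin.snoc b d : Fin (n + 1) → N) i)) =
      insert (c, d) (Set.range (fun i => (a i, b i))) := by
  ext p
  constructor
  · rintro ⟨i, rfl⟩
    refine Fin.lastCases ?_ (fun j => ?_) i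
    · simp
    · exact Or.inr ⟨j, by simp⟩
  · rintro (rfl | ⟨i, rfl⟩)
    · exact ⟨Fin.last n, by simp⟩
    · exact ⟨i.castSucc, by simp⟩

theorem iso_tr (A M N : Type) [Lrel.Structure A] [Lrel.Structure M] [Lrel.Structure N]
    [Countable M] [Countable N]
    (hM : M ⊨ Lrel.completeTheory A) (hN : N ⊨ Lrel.completeTheory A)
    (hinj : ∀ k, ∀ a ∈ rl A k, Function.Injective a) (hom : ∀ s, Homogeneous (QQ (rl A) s)) :
    Nonempty (M ≃[Lrel] N) := by
  have hMi := inj_tr A M hM hinj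
  have hNi := inj_tr A N hN hinj
  obtain ⟨S, hS, -, hQ, hU, hV⟩ := bf (BQ M N) Set.univ Set.univ Set.countable_univ
    Set.countable_univ (by
      rintro _ ⟨n, a, b, hab, rfl⟩ c -
      obtain ⟨d, hd⟩ := ext_tr A M N hM hN hinj hom a b hab c
      refine ⟨_, ?_, ⟨n + 1, _, _, hd, rfl⟩, d, ?_⟩
      · rw [range_snoc]; exact Set.subset_insert _ _
      · rw [range_snoc]; exact Set.mem_insert _ _) (by
      rintro _ ⟨n, a, b, hab, rfl⟩ d -
      obtain ⟨c, hc⟩ := ext_tr A N M hN hM hinj hom b a hab.symm d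
      refine ⟨_, ?_, ⟨n + 1, _, _, hc.symm, rfl⟩, c, ?_⟩
      · rw [range_snoc]; exact Set.subset_insert _ _
      · rw [range_snoc]; exact Set.mem_insert _ _) ∅
    ⟨0, Fin.elim0, Fin.elim0, ⟨fun i => i.elim0, fun k hk => by omega⟩, by simp⟩
  have key : ∀ (m : ℕ) (x : Fin m → M) (y : Fin m → N), (∀ i, ∃ n, (x i, y i) ∈ S n) →
      ST (rl M) (rl N) x y := by
    intro m x y h
    choose n hn using h
    obtain ⟨p, a, b, hab, e⟩ := hQ (Finset.univ.sup n)
    have h1 : ∀ i, ∃ j, (a j, b j) = (x i, y i) := by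
      intro i
      have := hS (Finset.le_sup (f := n) (Finset.mem_univ i)) (hn i)
      rw [e] at this
      exact this
    choose f hf using h1
    have hx : x = a ∘ f := funext fun i => (congrArg Prod.fst (hf i)).symm
    have hy : y = b ∘ f := funext fun i => (congrArg Prod.snd (hf i)).symm
    rw [hx, hy]
    exact hab.restrict hMi hNi f
  have hU' : ∀ x : M, ∃ y : N, ∃ n, (x, y) ∈ S n := fun x => hU x trivial
  have hV' : ∀ y : N, ∃ x : M, ∃ n, (x, y) ∈ S n := fun y => hV y trivial
  choose F hF using hU'
  have hpair : ∀ x x' y y', (∃ n, (x, y) ∈ S n) → (∃ n, (x', y') ∈ S n) → (x = x' ↔ y = y') := by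
    intro x x' y y' h h'
    have := (key 2 ![x, x'] ![y, y'] (by
      intro i
      fin_cases i
      · exact h
      · exact h')).1 0 1
    simpa using this
  have hbij : Function.Bijective F := by
    constructor
    · intro x x' h
      exact (hpair _ _ _ _ (hF x) (hF x')).2 h
    · intro y
      obtain ⟨x, hx⟩ := hV' y
      exact ⟨x, (hpair _ _ _ _ (hF x) hx).1 rfl⟩
  exact ⟨{ toEquiv := Equiv.ofBijective F hbij
           map_fun' := fun f => f.elim
           map_rel' := by
            rintro m ⟨k, rfl⟩ x
            exact ((key (k + 1) x (F ∘ x) (fun i => hF (x i))).2 k (Nat.lt_succ_self k) id).symm }⟩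

theorem omegaCat {A : Type} [Infinite A] {ρ : ∀ k : ℕ, Set (Fin (k + 1) → A)}
    (hinj : ∀ k, ∀ a ∈ ρ k, Function.Injective a) (hom : ∀ s, Homogeneous (QQ ρ s)) :
    OmegaCategoricalTh ρ := by
  letI := LrelStruct ρ
  have hrl : rl A = ρ := rfl
  refine ⟨?_, ?_⟩
  · refine Language.Theory.exists_model_card_eq (L := Lrel) (T := Lrel.completeTheory A)
      ⟨Language.Theory.ModelType.of _ A, (inferInstance : Infinite A)⟩ Cardinal.aleph0 le_rfl ?_
    have hf : ∀ l, IsEmpty (Lrel.Functions l) := fun l => inferInstanceAs (IsEmpty Empty)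
    have hr : ∀ l, Countable (Lrel.Relations l) := fun l =>
      inferInstanceAs (Countable {k : ℕ // k + 1 = l})
    have : Countable Lrel.Symbols := by
      unfold Language.Symbols
      infer_instance
    have h2 : Lrel.card ≤ Cardinal.aleph0 := Cardinal.mk_le_aleph0
    simpa using h2
  · intro M N hM hN
    have : Countable M := Cardinal.mk_le_aleph0_iff.1 hM.le
    have : Countable N := Cardinal.mk_le_aleph0_iff.1 hN.le
    exact iso_tr A M N M.is_model N.is_model hinj hom

end KK

/-- There is a structure `𝐀 = (A; (ρ_m)_{m ≥ 1})` (here `ρ k`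
has arity `k+1`) on a set `A` of cardinality `ℵ₁` such that (1) `Th(𝐀)` is
ω-categorical, (2) for every `s`, every finite partial automorphism of the
reduct `𝐀^{[s]}` extends to an automorphism of `𝐀^{[s]}`, and (3) `𝐀` is
rigid.  Consequently `R = {ρ_m : m ≥ 1}` satisfies
`⟨R⟩_{KA} = ⟨R⟩_{inv,∩} ≠ sInv Aut R`; in particular there is a set of
finitary relations on a set of cardinality `ℵ₁` that is ∩-closed and closed
under all invariant operations but not Galois closed. -/
theorem stmt16 :
    ∃ (A : Type) (ρ : ∀ k : ℕ, Set (Fin (k + 1) → A)),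
      Cardinal.mk A = Cardinal.aleph 1 ∧
      OmegaCategoricalTh ρ ∧
      (∀ s : ℕ, Homogeneous {r : Rels A | ∃ k, k < s ∧ r = ⟨k, ρ k⟩}) ∧
      AutR {r : Rels A | ∃ k, r = ⟨k, ρ k⟩} = {1} ∧
      (KAClosure {r : Rels A | ∃ k, r = ⟨k, ρ k⟩} =
        invInterClosure {r : Rels A | ∃ k, r = ⟨k, ρ k⟩}) ∧
      (invInterClosure {r : Rels A | ∃ k, r = ⟨k, ρ k⟩} ≠
        sInvG (AutR {r : Rels A | ∃ k, r = ⟨k, ρ k⟩})) ∧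
      ∃ R : Set (Rels A), InterClosed R ∧ InvClosed R ∧ R ≠ sInvG (AutR R) := by
  obtain ⟨A, ρ, hA, hinj, hom, hrig⟩ := KK.core2
  have hinf : Infinite A := by
    rw [Cardinal.infinite_iff, hA]
    exact Cardinal.aleph0_le_aleph 1
  obtain ⟨h1, h2⟩ := KK.inv_eq_K0 hinj hom
  have hne := KK.K0_ne hinj hom
  have hu : sInvG ({1} : Set (Equiv.Perm A)) = Set.univ := by
    refine Set.eq_univ_of_forall fun r g hg => ?_
    obtain rfl : g = 1 := hg
    exact (KK.permImage_eq_iff _ _).2 fun a => Iff.rfl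
  refine ⟨A, ρ, hA, KK.omegaCat hinj hom, hom, hrig, h1.trans h2.symm, ?_, ?_⟩
  · have hrig' : AutR {r : Rels A | ∃ k, r = ⟨k, ρ k⟩} = {1} := hrig
    rw [hrig', hu]
    have h2' : invInterClosure {r : Rels A | ∃ k, r = ⟨k, ρ k⟩} = KK.K0 ρ := h2
    rw [h2']
    exact hne
  · refine ⟨KK.K0 ρ, KK.K0_inter ρ, KK.K0_inv hinj hom, ?_⟩
    have h3 : AutR (KK.K0 ρ) = {1} := by
      ext g
      constructor
      · intro hg
        rw [← hrig]
        exact fun r hr => hg r (KK.QA_sub_K0 ρ hr)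
      · intro hg
        obtain rfl : g = 1 := hg
        intro r _
        exact (KK.permImage_eq_iff _ _).2 fun a => Iff.rfl
    rw [h3, hu]
    exact hne
end

section
/- Let m ≥ 1 and let Q ⊆ Rel^{(m)}(A) be a set of m-ary relations on a nonempty set A that is closed under complementation. Then there exists a 2m-ary relation ρ ∈ ⟨Q⟩_{KA,∩}^{(2m)} with Aut Q = Aut {ρ}. -/
open FirstOrder

/-- `⟨Q⟩_{KA,∩}`: the least ∩-closed Krasner algebra containing `Q`. -/
def KAInterClosure {A : Type*} (Q : Set (Rels A)) : Set (Rels A) :=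
  ⋂₀ {R | Q ⊆ R ∧ KrasnerClosed R ∧ InterClosed R}

theorem aux_pull {A : Type*} {R : Set (Rels A)} (hK : KrasnerClosed R) {m n : ℕ}
    {σ : Set (Fin (m + 1) → A)} (hσ : (⟨m, σ⟩ : Rels A) ∈ R) (f : Fin (m + 1) → Fin (n + 1)) :
    (⟨n, {c | c ∘ f ∈ σ}⟩ : Rels A) ∈ R := by
  let r : (relLang 1 (fun _ => m + 1)).Relations (m + 1) := ⟨0, rfl⟩
  have h := hK 1 (fun _ => m) (fun _ => σ) (fun _ => hσ) n
    (Language.Relations.formula r (fun j => Language.Term.var (f j)))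
  have e : logicalOp (fun _ : Fin 1 => σ)
      (Language.Relations.formula r (fun j => Language.Term.var (f j))) = {c | c ∘ f ∈ σ} := by
    ext c
    letI := relStruct (fun _ : Fin 1 => σ)
    exact Language.Formula.realize_rel (R := r)
  rw [e] at h
  exact h

theorem aux_compl {A : Type*} {R : Set (Rels A)} (hK : KrasnerClosed R) {n : ℕ}
    {σ : Set (Fin (n + 1) → A)} (hσ : (⟨n, σ⟩ : Rels A) ∈ R) :
    (⟨n, σᶜ⟩ : Rels A) ∈ R := by
  let r : (relLang 1 (fun _ => n + 1)).Relations (n + 1) := ⟨0, rfl⟩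
  have h := hK 1 (fun _ => n) (fun _ => σ) (fun _ => hσ) n
    (Language.Formula.not (Language.Relations.formula r (fun j => Language.Term.var j)))
  have e : logicalOp (fun _ : Fin 1 => σ)
      (Language.Formula.not (Language.Relations.formula r (fun j => Language.Term.var j))) = σᶜ := by
    ext c
    letI := relStruct (fun _ : Fin 1 => σ)
    exact Language.Formula.realize_not.trans (not_congr (Language.Formula.realize_rel (R := r)))
  rw [e] at h
  exact h

theorem aux_perm {A : Type*} (g : Equiv.Perm A) {m : ℕ} (ρ : Set (Fin m → A)) :
    permImage g ρ = ρ ↔ ∀ c, ⇑g ∘ c ∈ ρ ↔ c ∈ ρ := by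
  have inv : ∀ c : Fin m → A, ⇑g ∘ (⇑g.symm ∘ c) = c := fun c => by ext i; simp
  have inv' : ∀ c : Fin m → A, ⇑g.symm ∘ (⇑g ∘ c) = c := fun c => by ext i; simp
  have key : ∀ c, ⇑g ∘ c ∈ permImage g ρ ↔ c ∈ ρ := by
    intro c
    constructor
    · rintro ⟨d, hd, e⟩
      have : d = c := by
        rw [← inv' d, ← inv' c]
        exact congrArg _ e
      exact this ▸ hd
    · intro h
      exact ⟨c, h, rfl⟩
  constructor
  · intro h c
    have := key c
    rwa [h] at this
  · intro h
    ext c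
    have h1 := key (⇑g.symm ∘ c)
    have h2 := h (⇑g.symm ∘ c)
    rw [inv] at h1 h2
    exact h1.trans h2.symm

theorem aux_pair {A : Type*} (m : ℕ) : ∃ f s : Fin (m + 1) → Fin (2 * m + 1 + 1),
    ∀ a b : Fin (m + 1) → A, ∃ c : Fin (2 * m + 1 + 1) → A, c ∘ f = a ∧ c ∘ s = b := by
  refine ⟨fun i => ⟨i, by omega⟩, fun i => ⟨m + 1 + i, by omega⟩, fun a b =>
    ⟨fun i => if h : i.1 < m + 1 then a ⟨i, h⟩ else b ⟨i - (m + 1), by omega⟩, ?_, ?_⟩⟩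
  · ext i
    have := i.2
    simp only [Function.comp]
    rw [dif_pos this]
  · ext i
    have : ¬ (m + 1 + i.1 < m + 1) := by omega
    simp only [Function.comp]
    rw [dif_neg this]
    congr 1
    ext
    simp

/-- Let `Q` be a set of `(m+1)`-ary relations on a nonempty
set `A` that is closed under complementation.  Then there is a `2(m+1)`-ary
relation `ρ ∈ ⟨Q⟩_{KA,∩}` with `Aut Q = Aut {ρ}`.  (Here the arity
`2*m + 1 + 1 = 2*(m+1)` is twice the arity `m+1` of the members of `Q`.) -/
theorem stmt17 {A : Type*} [Nonempty A] (m : ℕ) (Q : Set (Set (Fin (m + 1) → A)))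
    (hC : ∀ σ ∈ Q, σᶜ ∈ Q) :
    ∃ ρ : Set (Fin (2 * m + 1 + 1) → A),
      (⟨2 * m + 1, ρ⟩ : Rels A) ∈ KAInterClosure {r : Rels A | ∃ σ ∈ Q, r = ⟨m, σ⟩} ∧
      AutR {r : Rels A | ∃ σ ∈ Q, r = ⟨m, σ⟩} = AutR {(⟨2 * m + 1, ρ⟩ : Rels A)} := by
  classical
  obtain ⟨f, s, hfs⟩ := aux_pair (A := A) m
  let t : (Fin (m + 1) → A) → Set (Set (Fin (m + 1) → A)) := fun a => {σ | σ ∈ Q ∧ a ∈ σ}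
  have ht : ∀ a b, t a = t b ↔ ∀ σ ∈ Q, (a ∈ σ ↔ b ∈ σ) := by
    intro a b
    simp only [t, Set.ext_iff, Set.mem_setOf_eq]
    exact forall_congr' fun σ => by tauto
  let W : Set (Set (Fin (m + 1) → A)) → Set (Set (Fin (m + 1) → A)) → Prop := WellOrderingRel
  have wf : WellFounded W := IsWellFounded.wf
  refine ⟨{c | W (t (c ∘ f)) (t (c ∘ s))}, ?_, ?_⟩
  · rintro R ⟨hQ, hK, -, hI⟩
    have hp : ∀ (p : Fin (m + 1) → Fin (2 * m + 1 + 1)) (a : Fin (m + 1) → A), ∀ σ ∈ Q,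
        (⟨2 * m + 1, {c | c ∘ p ∈ σ ↔ a ∈ σ}⟩ : Rels A) ∈ R := by
      intro p a σ hσ
      have h1 := aux_pull hK (hQ ⟨σ, hσ, rfl⟩) p
      by_cases ha : a ∈ σ
      · simpa [ha] using h1
      · have h2 := aux_compl hK h1
        have e : {c : Fin (2 * m + 1 + 1) → A | c ∘ p ∈ σ ↔ a ∈ σ} = {c | c ∘ p ∈ σ}ᶜ := by
          ext c; simp [ha]
        rw [e]; exact h2
    have hd : ∀ d : Fin (2 * m + 1 + 1) → A,
        (⟨2 * m + 1, {c | t (c ∘ f) = t (d ∘ f) ∧ t (c ∘ s) = t (d ∘ s)}⟩ : Rels A) ∈ R := by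
      intro d
      have h := hI (2 * m + 1) {S | ∃ σ ∈ Q, S = {c | c ∘ f ∈ σ ↔ d ∘ f ∈ σ} ∨
        S = {c | c ∘ s ∈ σ ↔ d ∘ s ∈ σ}} (by
          rintro S ⟨σ, hσ, rfl | rfl⟩
          · exact hp f _ σ hσ
          · exact hp s _ σ hσ)
      convert h using 2
      ext c
      simp only [ht, Set.mem_setOf_eq, Set.mem_sInter]
      constructor
      · rintro ⟨h1, h2⟩ S ⟨σ, hσ, rfl | rfl⟩
        · exact h1 σ hσ
        · exact h2 σ hσ
      · intro h
        exact ⟨fun σ hσ => h _ ⟨σ, hσ, Or.inl rfl⟩, fun σ hσ => h _ ⟨σ, hσ, Or.inr rfl⟩⟩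
    have h := hI (2 * m + 1) {S | ∃ d : Fin (2 * m + 1 + 1) → A, ¬ W (t (d ∘ f)) (t (d ∘ s)) ∧
        S = {c | t (c ∘ f) = t (d ∘ f) ∧ t (c ∘ s) = t (d ∘ s)}ᶜ} (by
          rintro S ⟨d, -, rfl⟩
          exact aux_compl hK (hd d))
    refine Set.mem_of_eq_of_mem (congrArg (fun S => (⟨2 * m + 1, S⟩ : Rels A)) ?_) h
    ext c
    simp only [Set.mem_setOf_eq, Set.mem_sInter]
    constructor
    · rintro h S ⟨d, hd, rfl⟩ ⟨h1, h2⟩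
      rw [h1, h2] at h
      exact hd h
    · intro h
      by_contra hc
      exact h _ ⟨c, hc, rfl⟩ ⟨rfl, rfl⟩
  · ext g
    have key : (∀ σ ∈ Q, permImage g σ = σ) ↔ ∀ a, t (⇑g ∘ a) = t a := by
      simp only [aux_perm, ht]
      exact ⟨fun h a σ hσ => h σ hσ a, fun h σ hσ a => h a σ hσ⟩
    have hl : g ∈ AutR {r : Rels A | ∃ σ ∈ Q, r = ⟨m, σ⟩} ↔ ∀ σ ∈ Q, permImage g σ = σ :=
      ⟨fun h σ hσ => h ⟨m, σ⟩ ⟨σ, hσ, rfl⟩, by rintro h _ ⟨σ, hσ, rfl⟩; exact h σ hσ⟩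
    rw [hl, key]
    have hr : g ∈ AutR {(⟨2 * m + 1, {c | W (t (c ∘ f)) (t (c ∘ s))}⟩ : Rels A)} ↔
        ∀ a b, W (t (⇑g ∘ a)) (t (⇑g ∘ b)) ↔ W (t a) (t b) := by
      have : g ∈ AutR {(⟨2 * m + 1, {c | W (t (c ∘ f)) (t (c ∘ s))}⟩ : Rels A)} ↔
        permImage g {c | W (t (c ∘ f)) (t (c ∘ s))} = {c | W (t (c ∘ f)) (t (c ∘ s))} :=
        ⟨fun h => h _ rfl, by rintro h _ rfl; exact h⟩
      rw [this, aux_perm]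
      constructor
      · intro h a b
        obtain ⟨c, rfl, rfl⟩ := hfs a b
        exact h c
      · intro h c
        exact h (c ∘ f) (c ∘ s)
    rw [hr]
    constructor
    · intro h a b
      rw [h, h]
    · intro h
      have gen : ∀ k : Equiv.Perm A, (∀ a b, W (t (⇑k ∘ a)) (t (⇑k ∘ b)) ↔ W (t a) (t b)) →
          ∀ a, ¬ W (t (⇑k ∘ a)) (t a) := by
        intro k hk a
        induction a using (InvImage.wf t wf).induction with
        | _ a ih =>
          intro h1
          exact ih (⇑k ∘ a) h1 ((hk _ _).2 h1)
      have inv : ∀ c : Fin (m + 1) → A, ⇑g ∘ (⇑g.symm ∘ c) = c := fun c => by ext i; simp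
      have inv' : ∀ c : Fin (m + 1) → A, ⇑g.symm ∘ (⇑g ∘ c) = c := fun c => by ext i; simp
      intro a
      have h1 := gen g h a
      have h2 := gen g.symm (fun a b => by rw [← h, inv, inv]) (⇑g ∘ a)
      rw [inv'] at h2
      rcases trichotomous_of WellOrderingRel (t (⇑g ∘ a)) (t a) with h3 | h3 | h3
      · exact absurd h3 h1
      · exact h3
      · exact absurd h3 h2
end

section
/- For every set R of finitary relations on a nonempty set A there exists an at most countable set R_0 of finitary relations on A with Aut R = Aut R_0. Moreover, if R is a ∩-closed Krasner algebra, then R_0 can be chosen with R_0 ⊆ R. -/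
open FirstOrder

theorem permImage_eq_iff {A : Type*} (g : Equiv.Perm A) {m : ℕ} (ρ : Set (Fin m → A)) :
    permImage g ρ = ρ ↔ ∀ c, (⇑g ∘ c ∈ ρ ↔ c ∈ ρ) := by
  have hinj : Function.Injective (fun a : Fin m → A => ⇑g ∘ a) :=
    fun a b h => g.injective.comp_left h
  constructor
  · intro h c
    constructor
    · intro hc
      rw [← h] at hc
      obtain ⟨d, hd, e⟩ := hc
      rwa [← hinj e]
    · intro hc
      rw [← h]
      exact ⟨c, hc, rfl⟩
  · intro h
    ext c
    constructor
    · rintro ⟨d, hd, rfl⟩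
      exact (h d).2 hd
    · intro hc
      refine ⟨⇑g.symm ∘ c, (h _).1 ?_, ?_⟩
      · convert hc using 1
        funext i
        simp
      · funext i
        simp

theorem core_lemma {A : Type*} (R : Set (Rels A))
    (hI : InterClosed R)
    (hC : ∀ (m : ℕ) (ρ : Set (Fin (m + 1) → A)), (⟨m, ρ⟩ : Rels A) ∈ R →
      (⟨m, ρᶜ⟩ : Rels A) ∈ R)
    (hS : ∀ (m k : ℕ) (f : Fin (m + 1) → Fin (k + 1)) (ρ : Set (Fin (m + 1) → A)),
      (⟨m, ρ⟩ : Rels A) ∈ R → (⟨k, {c | c ∘ f ∈ ρ}⟩ : Rels A) ∈ R) :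
    ∃ R₀ : Set (Rels A), R₀ ⊆ R ∧ R₀.Countable ∧ AutR R = AutR R₀ := by
  let T : ∀ m : ℕ, (Fin (m + 1) → A) → Set (Set (Fin (m + 1) → A)) :=
    fun m a => {ρ | (⟨m, ρ⟩ : Rels A) ∈ R ∧ a ∈ ρ}
  have hatom : ∀ m a, (⟨m, {x | T m x = T m a}⟩ : Rels A) ∈ R := by
    intro m a
    have : {x | T m x = T m a} = ⋂₀ (T m a) := by
      ext x
      constructor
      · intro hx ρ hρ
        have hx' : T m x = T m a := hx
        rw [← hx'] at hρ
        exact hρ.2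
      · intro hx
        show T m x = T m a
        ext ρ
        constructor
        · intro hρ
          refine ⟨hρ.1, ?_⟩
          by_contra hn
          exact hx ρᶜ ⟨hC m ρ hρ.1, hn⟩ hρ.2
        · intro hρ
          exact ⟨hρ.1, hx ρ hρ⟩
    rw [this]
    exact hI.2 m _ (fun ρ hρ => hρ.1)
  let l : ∀ m : ℕ, Fin (m + 1) → Fin ((m + 1 + m) + 1) := fun m => Fin.castAdd (m + 1)
  let r : ∀ m : ℕ, Fin (m + 1) → Fin ((m + 1 + m) + 1) := fun m => Fin.natAdd (m + 1)
  let P : ∀ m : ℕ, Set (Fin ((m + 1 + m) + 1) → A) := fun m =>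
    {c | WellOrderingRel (T m (c ∘ l m)) (T m (c ∘ r m))}
  have hinter : ∀ m (ρ σ : Set (Fin (m + 1) → A)), (⟨m, ρ⟩ : Rels A) ∈ R →
      (⟨m, σ⟩ : Rels A) ∈ R → (⟨m, ρ ∩ σ⟩ : Rels A) ∈ R := by
    intro m ρ σ h1 h2
    rw [← Set.sInter_pair]
    apply hI.2
    rintro x (rfl | rfl) <;> assumption
  have hP : ∀ m, (⟨m + 1 + m, P m⟩ : Rels A) ∈ R := by
    intro m
    have : P m = (⋂₀ {X | ∃ a b, WellOrderingRel (T m a) (T m b) ∧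
        X = ({c | c ∘ l m ∈ {x | T m x = T m a}} ∩
          {c | c ∘ r m ∈ {x | T m x = T m b}})ᶜ})ᶜ := by
      ext c
      constructor
      · intro hc hn
        exact hn _ ⟨c ∘ l m, c ∘ r m, hc, rfl⟩ ⟨rfl, rfl⟩
      · intro hc
        by_contra hn
        apply hc
        rintro X ⟨a, b, hab, rfl⟩ ⟨h1, h2⟩
        apply hn
        have h1' : T m (c ∘ l m) = T m a := h1
        have h2' : T m (c ∘ r m) = T m b := h2
        show WellOrderingRel (T m (c ∘ l m)) (T m (c ∘ r m))
        rw [h1', h2']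
        exact hab
    rw [this]
    apply hC
    apply hI.2
    rintro X ⟨a, b, hab, rfl⟩
    exact hC _ _ (hinter _ _ _ (hS _ _ _ _ (hatom m a)) (hS _ _ _ _ (hatom m b)))
  refine ⟨Set.range (fun m : ℕ => (⟨m + 1 + m, P m⟩ : Rels A)), ?_, Set.countable_range _, ?_⟩
  · rintro _ ⟨m, rfl⟩
    exact hP m
  apply Set.Subset.antisymm
  · rintro g hg _ ⟨m, rfl⟩
    exact hg _ (hP m)
  · rintro g hg ⟨m, ρ⟩ hρ
    have h0 : permImage g (P m) = P m := hg _ ⟨m, rfl⟩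
    rw [permImage_eq_iff] at h0
    have h1 : ∀ a b, WellOrderingRel (T m (⇑g ∘ a)) (T m (⇑g ∘ b)) ↔
        WellOrderingRel (T m a) (T m b) := by
      intro a b
      let c : Fin ((m + 1 + m) + 1) → A := Fin.append (m := m + 1) (n := m + 1) a b
      have hl : c ∘ l m = a := by
        funext i
        exact Fin.append_left a b i
      have hr : c ∘ r m = b := by
        funext i
        exact Fin.append_right a b i
      have := h0 c
      change WellOrderingRel (T m (⇑g ∘ (c ∘ l m))) (T m (⇑g ∘ (c ∘ r m))) ↔
        WellOrderingRel (T m (c ∘ l m)) (T m (c ∘ r m)) at this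
      rwa [hl, hr] at this
    have wf : WellFounded (WellOrderingRel (α := Set (Set (Fin (m + 1) → A)))) :=
      IsWellFounded.wf
    have key : ∀ t, ∀ a, T m a = t → T m (⇑g ∘ a) = T m a := by
      intro t
      induction t using wf.induction with
      | _ t ih =>
        rintro a rfl
        rcases trichotomous_of WellOrderingRel (T m (⇑g ∘ a)) (T m a) with h | h | h
        · have h2 := (h1 _ _).2 h
          rw [ih _ h _ rfl] at h2
          exact absurd h2 (irrefl_of WellOrderingRel _)
        · exact h
        · have e : ⇑g ∘ (⇑g.symm ∘ a) = a := by
            funext i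
            simp
          have h2 : WellOrderingRel (T m (⇑g.symm ∘ a)) (T m a) := by
            rw [← h1, e]
            exact h
          have h3 := ih _ h2 _ rfl
          rw [e] at h3
          rw [← h3] at h2
          exact absurd h2 (irrefl_of WellOrderingRel _)
    show permImage g ρ = ρ
    rw [permImage_eq_iff]
    intro c
    have hk := key _ c rfl
    constructor
    · intro h
      have : ρ ∈ T m (⇑g ∘ c) := ⟨hρ, h⟩
      rw [hk] at this
      exact this.2
    · intro h
      have : ρ ∈ T m c := ⟨hρ, h⟩
      rw [← hk] at this
      exact this.2

def symb0 (m : ℕ) : (relLang 1 (fun _ => m + 1)).Relations (m + 1) :=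
  (⟨0, rfl⟩ : {i : Fin 1 // m + 1 = m + 1})

theorem krasner_subst {A : Type*} {R : Set (Rels A)} (hK : KrasnerClosed R)
    (m k : ℕ) (f : Fin (m + 1) → Fin (k + 1)) (ρ : Set (Fin (m + 1) → A))
    (h : (⟨m, ρ⟩ : Rels A) ∈ R) : (⟨k, {c | c ∘ f ∈ ρ}⟩ : Rels A) ∈ R := by
  have := hK 1 (fun _ => m) (fun _ => ρ) (fun _ => h) k
    (Language.Relations.formula (L := relLang 1 (fun _ => m + 1)) (n := m + 1)
      (symb0 m) (fun i => Language.Term.var (f i)))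
  convert this using 2
  ext c
  letI := relStruct (A := A) (n := 1) (k := fun _ => m + 1) (fun _ => ρ)
  show _ ↔ Language.Formula.Realize _ c
  rw [Language.Formula.realize_rel]
  rfl

theorem krasner_compl {A : Type*} {R : Set (Rels A)} (hK : KrasnerClosed R)
    (m : ℕ) (ρ : Set (Fin (m + 1) → A))
    (h : (⟨m, ρ⟩ : Rels A) ∈ R) : (⟨m, ρᶜ⟩ : Rels A) ∈ R := by
  have := hK 1 (fun _ => m) (fun _ => ρ) (fun _ => h) m
    (Language.Formula.not (Language.Relations.formula (L := relLang 1 (fun _ => m + 1)) (n := m + 1)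
      (symb0 m) (fun i => Language.Term.var i)))
  convert this using 2
  ext c
  letI := relStruct (A := A) (n := 1) (k := fun _ => m + 1) (fun _ => ρ)
  show _ ↔ Language.Formula.Realize _ c
  rw [Language.Formula.realize_not, Language.Formula.realize_rel]
  rfl

/-- For every set `R` of finitary relations on a nonempty set
`A` there is an at most countable set `R₀` with `Aut R = Aut R₀`; moreover if
`R` is a ∩-closed Krasner algebra then `R₀` can be chosen inside `R`. -/
theorem stmt18 {A : Type*} [Nonempty A] (R : Set (Rels A)) :
    (∃ R₀ : Set (Rels A), R₀.Countable ∧ AutR R = AutR R₀) ∧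
    (KrasnerClosed R → InterClosed R →
      ∃ R₀ : Set (Rels A), R₀ ⊆ R ∧ R₀.Countable ∧ AutR R = AutR R₀) := by
  constructor
  · let R' : Set (Rels A) := {ρ | ∀ g ∈ AutR R, ∀ c, (⇑g ∘ c ∈ ρ.2 ↔ c ∈ ρ.2)}
    have hR : AutR R = AutR R' := by
      apply Set.Subset.antisymm
      · intro g hg ρ hρ
        exact (permImage_eq_iff g ρ.2).2 (hρ g hg)
      · intro g hg ρ hρ
        exact hg ρ (fun g' hg' => (permImage_eq_iff g' ρ.2).1 (hg' ρ hρ))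
    obtain ⟨R₀, -, h2, h3⟩ := core_lemma R' ⟨fun m g hg c => Iff.rfl, fun m Q hQ g hg c =>
        ⟨fun h ρ hρ => (hQ ρ hρ g hg c).1 (h ρ hρ), fun h ρ hρ => (hQ ρ hρ g hg c).2 (h ρ hρ)⟩⟩
      (fun m ρ h g hg c => not_congr (h g hg c))
      (fun m k f ρ h g hg c => h g hg (c ∘ f))
    exact ⟨R₀, h2, hR.trans h3⟩
  · intro hK hI
    exact core_lemma R hI (krasner_compl hK) (krasner_subst hK)
end
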